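/- arXiv:2410.22873 — 5 statements merged into one kernel-verified Lean document; each statement's English description precedes it below -/
import Mathlib

section
/- Assume m₁ = 0. Fix an integer k ≥ 2 and for ε > 0 define F_ε^{(k)}(u) := ε^{−k} ( u(Q_Ω) + ε^{−2s} ∫_Ω W(u(x)) dx ). Then the Γ-limit (with respect to L¹(Ω) convergence) of F_ε^{(k)} as ε ↘ 0 equals 0 on U₁ and +∞ on X_g \ U₁; precisely: (a) for every u ∈ X_g \ U₁, every sequence ε_j ↘ 0 and every sequence u_j ∈ X_g with u_j → u in L¹(Ω), liminf_{j→∞} F_{ε_j}^{(k)}(u_j) = +∞; (b) for every u ∈ U₁ one has u(Q_Ω) = 0 and W(u) = 0 a.e. on Ω, so F_ε^{(k)}(u) = 0 for all ε > 0 and the constant family v_ε := u satisfies v_ε → u in L¹(Ω) and F_ε^{(k)}(v_ε) → 0. -/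
open MeasureTheory Filter Set Metric
open scoped ENNReal NNReal Topology RealInnerProductSpace

noncomputable section

/-- The kinetic (Gagliardo) energy of `u` over `Q_Ω = (ℝⁿ × ℝⁿ) \ (Ωᶜ × Ωᶜ)`,
with fractional parameter `s`. -/
def JQ (n : ℕ) (s : ℝ) (Ω : Set (EuclideanSpace ℝ (Fin n)))
    (u : EuclideanSpace ℝ (Fin n) → ℝ) : ℝ≥0∞ :=
  ∫⁻ z : EuclideanSpace ℝ (Fin n) × EuclideanSpace ℝ (Fin n) in (Ωᶜ ×ˢ Ωᶜ)ᶜ,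
    ENNReal.ofReal (|u z.1 - u z.2| ^ 2 / ‖z.1 - z.2‖ ^ ((n : ℝ) + 2 * s))

/-- The class `X_g` of admissible functions: measurable, with values in `[-1,1]`,
agreeing a.e. with the exterior datum `g` outside `Ω`. -/
def Xg (n : ℕ) (Ω : Set (EuclideanSpace ℝ (Fin n))) (g : EuclideanSpace ℝ (Fin n) → ℝ) :
    Set (EuclideanSpace ℝ (Fin n) → ℝ) :=
  {u | Measurable u ∧ (∀ x, u x ∈ Icc (-1 : ℝ) 1) ∧
    (∀ᵐ x ∂(volume.restrict Ωᶜ), u x = g x)}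

/-- The function `χ_E - χ_{E^c}`. -/
def pm (n : ℕ) (E : Set (EuclideanSpace ℝ (Fin n))) (x : EuclideanSpace ℝ (Fin n)) : ℝ :=
  E.indicator (fun _ => (1 : ℝ)) x - Eᶜ.indicator (fun _ => (1 : ℝ)) x

/-- `u` coincides a.e. on `Ω` with `χ_E - χ_{E^c}` for some measurable set `E`. -/
def IsPhase (n : ℕ) (Ω : Set (EuclideanSpace ℝ (Fin n)))
    (u : EuclideanSpace ℝ (Fin n) → ℝ) : Prop :=
  ∃ E : Set (EuclideanSpace ℝ (Fin n)), MeasurableSet E ∧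
    (∀ᵐ x ∂(volume.restrict Ω), u x = pm n E x)

/-- The minimal first-order energy `m₁`. -/
def m1 (n : ℕ) (s : ℝ) (Ω : Set (EuclideanSpace ℝ (Fin n)))
    (g : EuclideanSpace ℝ (Fin n) → ℝ) : ℝ≥0∞ :=
  ⨅ (u : EuclideanSpace ℝ (Fin n) → ℝ) (_ : u ∈ Xg n Ω g) (_ : IsPhase n Ω u), JQ n s Ω u

/-- The set `U₁` of minimizers of the first-order functional. -/
def U1 (n : ℕ) (s : ℝ) (Ω : Set (EuclideanSpace ℝ (Fin n)))
    (g : EuclideanSpace ℝ (Fin n) → ℝ) : Set (EuclideanSpace ℝ (Fin n) → ℝ) :=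
  {u | u ∈ Xg n Ω g ∧ IsPhase n Ω u ∧ JQ n s Ω u = m1 n s Ω g}

/-- The rescaled energy functional `F_ε^{(1)}(u) = u(Q_Ω) + ε^{-2s} ∫_Ω W(u)`. -/
def F1 (n : ℕ) (s : ℝ) (Ω : Set (EuclideanSpace ℝ (Fin n))) (W : ℝ → ℝ) (ε : ℝ)
    (u : EuclideanSpace ℝ (Fin n) → ℝ) : ℝ≥0∞ :=
  JQ n s Ω u + ENNReal.ofReal (ε ^ (-(2 * s))) * ∫⁻ x in Ω, ENNReal.ofReal (W (u x))

/-- `Ω` has Lipschitz boundary: near every boundary point, after a rotation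
(determined by the unit vector `e`), `Ω` is the open epigraph of a Lipschitz function. -/
def HasLipschitzBoundary (n : ℕ) (Ω : Set (EuclideanSpace ℝ (Fin n))) : Prop :=
  ∀ x₀ ∈ frontier Ω, ∃ r > (0 : ℝ), ∃ L > (0 : ℝ),
    ∃ e : EuclideanSpace ℝ (Fin n), ‖e‖ = 1 ∧
      ∃ ψ : EuclideanSpace ℝ (Fin n) → ℝ, (∀ x y, |ψ x - ψ y| ≤ L * ‖x - y‖) ∧
        Ω ∩ ball x₀ r = {y ∈ ball x₀ r | ψ (y - ⟪y, e⟫ • e) < ⟪y, e⟫}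

/-- The higher-order rescaled functionals
`F_ε^{(k)}(u) = ε^{-k} ( u(Q_Ω) + ε^{-2s} ∫_Ω W(u) )`. -/
def Fk (n : ℕ) (s : ℝ) (Ω : Set (EuclideanSpace ℝ (Fin n))) (W : ℝ → ℝ) (k : ℕ) (ε : ℝ)
    (u : EuclideanSpace ℝ (Fin n) → ℝ) : ℝ≥0∞ :=
  ENNReal.ofReal (ε ^ (-(k : ℝ))) *
    (JQ n s Ω u + ENNReal.ofReal (ε ^ (-(2 * s))) * ∫⁻ x in Ω, ENNReal.ofReal (W (u x)))

theorem lintegral_eq_zero_of_tendsto {α : Type*} [MeasurableSpace α] {μ : Measure α}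
    {f : ℕ → α → ℝ≥0∞} {F : α → ℝ≥0∞} (hf : ∀ j, Measurable (f j))
    (hlim : ∀ᵐ x ∂μ, Tendsto (fun j => f j x) atTop (𝓝 (F x)))
    (h0 : Tendsto (fun j => ∫⁻ x, f j x ∂μ) atTop (𝓝 0)) : ∫⁻ x, F x ∂μ = 0 := by
  refine le_antisymm ?_ zero_le
  calc ∫⁻ x, F x ∂μ = ∫⁻ x, liminf (fun j => f j x) atTop ∂μ :=
        lintegral_congr_ae (hlim.mono fun x hx => hx.liminf_eq.symm)
    _ ≤ liminf (fun j => ∫⁻ x, f j x ∂μ) atTop := lintegral_liminf_le hf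
    _ = 0 := h0.liminf_eq

theorem JQ_eq_zero_of_tendsto {n : ℕ} {s : ℝ} {Ω : Set (EuclideanSpace ℝ (Fin n))}
    {v : ℕ → EuclideanSpace ℝ (Fin n) → ℝ} {u : EuclideanSpace ℝ (Fin n) → ℝ}
    (hv : ∀ j, Measurable (v j))
    (hlim : ∀ᵐ x, Tendsto (fun j => v j x) atTop (𝓝 (u x)))
    (h0 : Tendsto (fun j => JQ n s Ω (v j)) atTop (𝓝 0)) : JQ n s Ω u = 0 := by
  refine lintegral_eq_zero_of_tendsto (fun j => ?_) (ae_restrict_of_ae ?_) h0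
  · have := hv j
    fun_prop
  · filter_upwards [Measure.quasiMeasurePreserving_fst.ae hlim,
      Measure.quasiMeasurePreserving_snd.ae hlim] with z h1 h2
    exact ENNReal.tendsto_ofReal ((((h1.sub h2).abs).pow 2).div_const _)

theorem lintegral_potential_eq_zero_of_tendsto {n : ℕ} {Ω : Set (EuclideanSpace ℝ (Fin n))}
    {W : ℝ → ℝ} (hW : Continuous W)
    {v : ℕ → EuclideanSpace ℝ (Fin n) → ℝ} {u : EuclideanSpace ℝ (Fin n) → ℝ}
    (hv : ∀ j, Measurable (v j))
    (hlim : ∀ᵐ x, Tendsto (fun j => v j x) atTop (𝓝 (u x)))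
    (h0 : Tendsto (fun j => ∫⁻ x in Ω, ENNReal.ofReal (W (v j x))) atTop (𝓝 0)) :
    ∫⁻ x in Ω, ENNReal.ofReal (W (u x)) = 0 :=
  lintegral_eq_zero_of_tendsto (fun j => (hW.measurable.comp (hv j)).ennreal_ofReal)
    (ae_restrict_of_ae (hlim.mono fun x hx =>
      ENNReal.tendsto_ofReal ((hW.tendsto (u x)).comp hx))) h0

theorem isPhase_of_ae {n : ℕ} {Ω : Set (EuclideanSpace ℝ (Fin n))}
    {u : EuclideanSpace ℝ (Fin n) → ℝ} (hu : Measurable u)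
    (h : ∀ᵐ x ∂(volume.restrict Ω), u x = -1 ∨ u x = 1) : IsPhase n Ω u := by
  refine ⟨u ⁻¹' {1}, hu (measurableSet_singleton 1), h.mono fun x hx => ?_⟩
  rcases hx with hx | hx <;> norm_num [pm, indicator, hx]

theorem IsPhase.ae_eq {n : ℕ} {Ω : Set (EuclideanSpace ℝ (Fin n))}
    {u : EuclideanSpace ℝ (Fin n) → ℝ} (h : IsPhase n Ω u) :
    ∀ᵐ x ∂(volume.restrict Ω), u x = -1 ∨ u x = 1 := by
  obtain ⟨E, -, hE⟩ := h
  refine hE.mono fun x hx => ?_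
  by_cases hxE : x ∈ E <;> simp [hx, pm, hxE]

/-- `L¹(Ω)`-convergent sequences in `X_g` converge a.e. on the whole space along a
subsequence. -/
theorem exists_subseq_tendsto_ae_of_mem_Xg {n : ℕ} {Ω : Set (EuclideanSpace ℝ (Fin n))}
    (hΩb : Bornology.IsBounded Ω) {g : EuclideanSpace ℝ (Fin n) → ℝ}
    {v : ℕ → EuclideanSpace ℝ (Fin n) → ℝ} {u : EuclideanSpace ℝ (Fin n) → ℝ}
    (hu : u ∈ Xg n Ω g) (hv : ∀ j, v j ∈ Xg n Ω g)
    (h : Tendsto (fun j => ∫ x in Ω, |v j x - u x|) atTop (𝓝 0)) :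
    ∃ ψ : ℕ → ℕ, StrictMono ψ ∧ ∀ᵐ x, Tendsto (fun j => v (ψ j) x) atTop (𝓝 (u x)) := by
  have : IsFiniteMeasure (volume.restrict Ω) :=
    ⟨by simpa using hΩb.measure_lt_top⟩
  have hint : ∀ j, Integrable (fun x => v j x - u x) (volume.restrict Ω) := fun j => by
    refine Integrable.of_bound ((hv j).1.sub hu.1).aestronglyMeasurable 2 (ae_of_all _ fun x => ?_)
    have h1 := (hv j).2.1 x
    have h2 := hu.2.1 x
    rw [Real.norm_eq_abs, abs_le]
    constructor <;> linarith [h1.1, h1.2, h2.1, h2.2]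
  have hnorm : Tendsto (fun j => eLpNorm (v j - u) 1 (volume.restrict Ω)) atTop (𝓝 0) := by
    have := ENNReal.tendsto_ofReal h
    rw [ENNReal.ofReal_zero] at this
    refine this.congr fun j => ?_
    rw [eLpNorm_one_eq_lintegral_enorm]
    exact ofReal_integral_norm_eq_lintegral_enorm (hint j)
  obtain ⟨ψ, hψ, hlim⟩ := (tendstoInMeasure_of_tendsto_eLpNorm one_ne_zero
    (fun j => (hv j).1.aestronglyMeasurable) hu.1.aestronglyMeasurable
    hnorm).exists_seq_tendsto_ae
  refine ⟨ψ, hψ, ae_of_ae_restrict_of_ae_restrict_compl Ω hlim ?_⟩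
  filter_upwards [hu.2.2, ae_all_iff.2 fun j => (hv j).2.2] with x hx hvx
  simp [hx, hvx]

/-- Bounded higher-order energy along `ε → 0` forces the unscaled energies to vanish. -/
theorem tendsto_energies_zero_of_Fk_le {n : ℕ} {s : ℝ} (hs : 0 < s)
    {Ω : Set (EuclideanSpace ℝ (Fin n))} {W : ℝ → ℝ} {k : ℕ} (hk : k ≠ 0)
    {ε : ℕ → ℝ} (hε : ∀ j, 0 < ε j) (hε0 : Tendsto ε atTop (𝓝 0))
    {v : ℕ → EuclideanSpace ℝ (Fin n) → ℝ} {C : ℝ≥0∞} (hC : C ≠ ⊤)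
    (hF : ∀ j, Fk n s Ω W k (ε j) (v j) ≤ C) :
    Tendsto (fun j => JQ n s Ω (v j)) atTop (𝓝 0) ∧
      Tendsto (fun j => ∫⁻ x in Ω, ENNReal.ofReal (W (v j x))) atTop (𝓝 0) := by
  have hbound : ∀ j, F1 n s Ω W (ε j) (v j) ≤ C * ENNReal.ofReal (ε j ^ k) := fun j => by
    have hpos : 0 < ε j ^ k := pow_pos (hε j) k
    have h := hF j
    rw [Fk, Real.rpow_neg (hε j).le, Real.rpow_natCast, ENNReal.ofReal_inv_of_pos hpos, mul_comm,
      ← div_eq_mul_inv] at h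
    exact (ENNReal.div_le_iff (by simpa using hpos) ENNReal.ofReal_ne_top).1 h
  have hlim : Tendsto (fun j => C * ENNReal.ofReal (ε j ^ k)) atTop (𝓝 0) := by
    have := ENNReal.tendsto_ofReal (hε0.pow k)
    rw [zero_pow hk, ENNReal.ofReal_zero] at this
    simpa using ENNReal.Tendsto.const_mul this (Or.inr hC)
  have hF1 := tendsto_of_tendsto_of_tendsto_of_le_of_le tendsto_const_nhds hlim
    (fun _ => zero_le) hbound
  refine ⟨tendsto_of_tendsto_of_tendsto_of_le_of_le tendsto_const_nhds hF1
    (fun _ => zero_le) (fun _ => le_self_add), ?_⟩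
  refine tendsto_of_tendsto_of_tendsto_of_le_of_le' tendsto_const_nhds hF1
    (Eventually.of_forall fun _ => zero_le) ?_
  filter_upwards [hε0.eventually_le_const one_pos] with j hj
  have h1 : 1 ≤ ENNReal.ofReal (ε j ^ (-(2 * s))) :=
    ENNReal.one_le_ofReal.2 (Real.one_le_rpow_of_pos_of_le_one_of_nonpos (hε j) hj (by linarith))
  exact (le_mul_of_one_le_left zero_le h1).trans le_add_self

/-- Theorem 1.3: if `m₁ = 0` and `k ≥ 2`, then the Γ-limit of `F_ε^{(k)}`
(with respect to `L¹(Ω)` convergence) is `0` on `U₁` and `+∞` on `X_g \ U₁`: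
(a) for `u ∈ X_g \ U₁` and any `ε_j ↘ 0`, `u_j ∈ X_g` with `u_j → u` in `L¹(Ω)`,
`liminf F_{ε_j}^{(k)}(u_j) = +∞`; (b) every `u ∈ U₁` satisfies `u(Q_Ω) = 0` and `W(u) = 0`
a.e. on `Ω`, so `F_ε^{(k)}(u) = 0` for all `ε > 0`, and `v_ε := u` is a recovery family. -/
theorem statement2
    (n : ℕ) (hn : 1 ≤ n) (s : ℝ) (hs : 0 < s) (hs' : s < 1 / 2)
    (Ω : Set (EuclideanSpace ℝ (Fin n))) (hΩo : IsOpen Ω) (hΩb : Bornology.IsBounded Ω)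
    (hΩl : HasLipschitzBoundary n Ω)
    (g : EuclideanSpace ℝ (Fin n) → ℝ) (hg : Continuous g)
    (hg1 : ∀ x, g x ∈ Icc (-1 : ℝ) 1)
    (W : ℝ → ℝ) (hW : Continuous W) (hW0 : ∀ t, 0 ≤ W t)
    (hWz : ∀ t, W t = 0 ↔ t = -1 ∨ t = 1)
    (hm1 : m1 n s Ω g = 0)
    (k : ℕ) (hk : 2 ≤ k) :
    (∀ u ∈ Xg n Ω g, u ∉ U1 n s Ω g →
      ∀ ε : ℕ → ℝ, (∀ j, 0 < ε j) → Tendsto ε atTop (𝓝 0) →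
      ∀ useq : ℕ → EuclideanSpace ℝ (Fin n) → ℝ, (∀ j, useq j ∈ Xg n Ω g) →
        Tendsto (fun j => ∫ x in Ω, |useq j x - u x|) atTop (𝓝 0) →
        liminf (fun j => Fk n s Ω W k (ε j) (useq j)) atTop = ⊤) ∧
    (∀ u ∈ U1 n s Ω g,
      JQ n s Ω u = 0 ∧
      (∀ᵐ x ∂(volume.restrict Ω), W (u x) = 0) ∧
      (∀ ε > (0 : ℝ), Fk n s Ω W k ε u = 0) ∧
      Tendsto (fun ε : ℝ => ∫ x in Ω, |u x - u x|) (𝓝[>] 0) (𝓝 0) ∧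
      Tendsto (fun ε : ℝ => Fk n s Ω W k ε u) (𝓝[>] 0) (𝓝 0)) := by
  constructor
  · intro u hu huU ε hε hε0 v hv hL
    by_contra hne
    obtain ⟨C, hlC, hC⟩ := exists_between (lt_top_iff_ne_top.2 hne)
    obtain ⟨φ, hφ, hφC⟩ := extraction_of_frequently_atTop
      (frequently_lt_of_liminf_lt (by isBoundedDefault) hlC)
    obtain ⟨ψ, hψ, hlim⟩ := exists_subseq_tendsto_ae_of_mem_Xg hΩb hu (fun j => hv (φ j))
      (hL.comp hφ.tendsto_atTop)
    obtain ⟨hJ, hP⟩ := tendsto_energies_zero_of_Fk_le hs (by omega : k ≠ 0)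
      (fun j => hε (φ (ψ j))) (hε0.comp (hφ.comp hψ).tendsto_atTop) hC.ne
      (fun j => (hφC (ψ j)).le)
    have hvm := fun j => (hv (φ (ψ j))).1
    have hJu := JQ_eq_zero_of_tendsto hvm hlim hJ
    have hPu := lintegral_potential_eq_zero_of_tendsto hW hvm hlim hP
    replace hPu := (lintegral_eq_zero_iff (hW.measurable.comp hu.1).ennreal_ofReal).1 hPu
    refine huU ⟨hu, isPhase_of_ae hu.1 (hPu.mono fun x hx => ?_), hJu.trans hm1.symm⟩
    exact (hWz _).1 (le_antisymm (ENNReal.ofReal_eq_zero.1 hx) (hW0 _))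
  · rintro u ⟨-, hphase, hmin⟩
    have hJ : JQ n s Ω u = 0 := hmin.trans hm1
    have hWu : ∀ᵐ x ∂(volume.restrict Ω), W (u x) = 0 := hphase.ae_eq.mono fun x => (hWz _).2
    have hP : ∫⁻ x in Ω, ENNReal.ofReal (W (u x)) = 0 := by
      rw [lintegral_congr_ae (hWu.mono fun x hx => by rw [hx, ENNReal.ofReal_zero]),
        lintegral_zero]
    have hF : ∀ ε, Fk n s Ω W k ε u = 0 := fun ε => by simp [Fk, hJ, hP]
    exact ⟨hJ, hWu, fun ε _ => hF ε, by simp, by simp [hF]⟩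
end
end

section
/- Let Ω' be an open set compactly contained in Ω, and let ρ := dist(Ω', ℝⁿ\Ω) > 0. Suppose E ⊆ ℝⁿ is a measurable set that minimizes H(·,Ω), i.e. H(E,Ω) ≤ H(F,Ω) for every measurable F ⊆ ℝⁿ. Then there exists a constant C > 0, depending only on n and s, such that for every measurable F ⊆ ℝⁿ with F \ Ω' = E \ Ω' (up to a set of measure zero) one has Per_s(E,Ω') ≤ Per_s(F,Ω') + C ρ^{−2s} |E Δ F|, where |E Δ F| is the Lebesgue measure of the symmetric difference. In particular, E is an almost minimizer of the fractional s-perimeter in Ω' with constant Λ = C ρ^{−2s}. -/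
open MeasureTheory Filter Set Metric
open scoped ENNReal NNReal Topology RealInnerProductSpace symmDiff

noncomputable section

/-- The functional `H(E,Ω)` from the paper:
`H(E,Ω) = ∬_{Ω×Ω} |(χ_E-χ_{E^c})(x) - (χ_E-χ_{E^c})(y)|²/|x-y|^{n+2s} dx dy
  + 2 ∬_{Ω×(ℝⁿ\Ω)} |(χ_E-χ_{E^c})(x) - g(y)|²/|x-y|^{n+2s} dx dy`. -/
def Hfun (n : ℕ) (s : ℝ) (Ω : Set (EuclideanSpace ℝ (Fin n)))
    (g : EuclideanSpace ℝ (Fin n) → ℝ) (E : Set (EuclideanSpace ℝ (Fin n))) : ℝ≥0∞ :=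
  (∫⁻ z : EuclideanSpace ℝ (Fin n) × EuclideanSpace ℝ (Fin n) in Ω ×ˢ Ω,
      ENNReal.ofReal (|pm n E z.1 - pm n E z.2| ^ 2 / ‖z.1 - z.2‖ ^ ((n : ℝ) + 2 * s))) +
  2 * ∫⁻ z : EuclideanSpace ℝ (Fin n) × EuclideanSpace ℝ (Fin n) in Ω ×ˢ Ωᶜ,
      ENNReal.ofReal (|pm n E z.1 - g z.2| ^ 2 / ‖z.1 - z.2‖ ^ ((n : ℝ) + 2 * s))

/-- The fractional `s`-perimeter of `E` in the open set `O`: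
`Per_s(E,O) = ∫_{E∩O}∫_{E^c} |x-y|^{-n-2s} + ∫_{E\O}∫_{E^c∩O} |x-y|^{-n-2s}`. -/
def fracPer (n : ℕ) (s : ℝ) (E O : Set (EuclideanSpace ℝ (Fin n))) : ℝ≥0∞ :=
  (∫⁻ z : EuclideanSpace ℝ (Fin n) × EuclideanSpace ℝ (Fin n) in (E ∩ O) ×ˢ Eᶜ,
      ENNReal.ofReal (‖z.1 - z.2‖ ^ (-(n : ℝ) - 2 * s))) +
  ∫⁻ z : EuclideanSpace ℝ (Fin n) × EuclideanSpace ℝ (Fin n) in (E \ O) ×ˢ (Eᶜ ∩ O),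
      ENNReal.ofReal (‖z.1 - z.2‖ ^ (-(n : ℝ) - 2 * s))

/-- The kernel `|x - y|^{-n-2s}`. -/
def fracKernel (n : ℕ) (s : ℝ)
    (z : EuclideanSpace ℝ (Fin n) × EuclideanSpace ℝ (Fin n)) : ℝ≥0∞ :=
  ENNReal.ofReal (‖z.1 - z.2‖ ^ (-(n : ℝ) - 2 * s))

@[fun_prop]
theorem measurable_fracKernel (n : ℕ) (s : ℝ) : Measurable (fracKernel n s) := by
  unfold fracKernel
  fun_prop

theorem fracKernel_swap (n : ℕ) (s : ℝ)
    (z : EuclideanSpace ℝ (Fin n) × EuclideanSpace ℝ (Fin n)) :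
    fracKernel n s z.swap = fracKernel n s z := by
  simp only [fracKernel, Prod.fst_swap, Prod.snd_swap, norm_sub_rev]

/-- Integrals of functions of `x / d` over `ℝⁿ` scale like `d ^ n`. -/
theorem lintegral_comp_inv_smul {n : ℕ} {d : ℝ} (hd : 0 < d)
    {φ : EuclideanSpace ℝ (Fin n) → ℝ≥0∞} (hφ : Measurable φ) :
    ∫⁻ z, φ (d⁻¹ • z) = ENNReal.ofReal (d ^ (n : ℝ)) * ∫⁻ z, φ z := by
  have h := Measure.map_addHaar_smul (volume : Measure (EuclideanSpace ℝ (Fin n)))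
    (inv_ne_zero hd.ne')
  rw [← lintegral_map hφ (by fun_prop : Measurable fun z : EuclideanSpace ℝ (Fin n) => d⁻¹ • z),
    h, lintegral_smul_measure, smul_eq_mul]
  congr 2
  rw [finrank_euclideanSpace_fin, inv_pow, inv_inv, abs_of_pos (by positivity), Real.rpow_natCast]

/-- The kernel integrated outside a ball of radius `d` is at most a constant times `d^{-2s}`. -/
theorem exists_lintegral_fracKernel_le (n : ℕ) {s : ℝ} (hs : 0 < s) :
    ∃ T > (0 : ℝ), ∀ (x : EuclideanSpace ℝ (Fin n)) (d : ℝ), 0 < d →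
      ∫⁻ y in {y | d ≤ dist x y}, fracKernel n s (x, y) ≤ ENNReal.ofReal (T * d ^ (-(2 * s))) := by
  set p : ℝ := n + 2 * s with hp
  have hp0 : 0 < p := by positivity
  set I : ℝ≥0∞ := ∫⁻ z : EuclideanSpace ℝ (Fin n), ENNReal.ofReal ((1 + ‖z‖) ^ (-p))
  have hI : I < ∞ := finite_integral_one_add_norm (by rw [finrank_euclideanSpace_fin]; linarith)
  refine ⟨2 ^ p * (I.toReal + 1), by positivity, fun x d hd => ?_⟩
  have hpt : ∀ y ∈ {y | d ≤ dist x y}, fracKernel n s (x, y) ≤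
      ENNReal.ofReal (2 ^ p * d ^ (-p)) *
        ENNReal.ofReal ((1 + ‖d⁻¹ • (y - x)‖) ^ (-p)) := by
    intro y hy
    rw [← ENNReal.ofReal_mul (by positivity)]
    refine ENNReal.ofReal_le_ofReal ?_
    have hy' : d ≤ ‖x - y‖ := by simpa [dist_eq_norm] using hy
    have hpos : 0 < ‖x - y‖ := hd.trans_le hy'
    have hexp : -(n : ℝ) - 2 * s = -p := by rw [hp]; ring
    have hfac : 1 + ‖d⁻¹ • (y - x)‖ = d⁻¹ * (d + ‖x - y‖) := by
      rw [norm_smul, norm_inv, Real.norm_of_nonneg hd.le, norm_sub_rev]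
      field_simp
    have h2 : (2 : ℝ) ^ p = (2⁻¹ : ℝ) ^ (-p) := by
      rw [Real.inv_rpow zero_le_two, Real.rpow_neg zero_le_two, inv_inv]
    simp only [hexp]
    rw [hfac, h2, ← Real.mul_rpow (by positivity) (by positivity),
      ← Real.mul_rpow (by positivity) (by positivity)]
    refine Real.rpow_le_rpow_of_nonpos (by positivity) ?_ (by linarith)
    field_simp
    linarith
  calc ∫⁻ y in {y | d ≤ dist x y}, fracKernel n s (x, y)
      ≤ ∫⁻ y in {y | d ≤ dist x y}, ENNReal.ofReal (2 ^ p * d ^ (-p)) *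
          ENNReal.ofReal ((1 + ‖d⁻¹ • (y - x)‖) ^ (-p)) := setLIntegral_mono (by fun_prop) hpt
    _ ≤ ∫⁻ y, ENNReal.ofReal (2 ^ p * d ^ (-p)) *
          ENNReal.ofReal ((1 + ‖d⁻¹ • (y - x)‖) ^ (-p)) := setLIntegral_le_lintegral _ _
    _ = ENNReal.ofReal (2 ^ p * d ^ (-p)) * (ENNReal.ofReal (d ^ (n : ℝ)) * I) := by
        rw [lintegral_const_mul _ (by fun_prop), lintegral_sub_right_eq_self
          (fun y => ENNReal.ofReal ((1 + ‖d⁻¹ • y‖) ^ (-p))) x,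
          lintegral_comp_inv_smul hd (φ := fun y => ENNReal.ofReal ((1 + ‖y‖) ^ (-p)))
            (by fun_prop)]
    _ ≤ ENNReal.ofReal (2 ^ p * d ^ (-p)) *
          (ENNReal.ofReal (d ^ (n : ℝ)) * ENNReal.ofReal (I.toReal + 1)) := by
        gcongr
        exact ENNReal.le_ofReal_iff_toReal_le hI.ne (by positivity) |>.2 (by linarith)
    _ = ENNReal.ofReal (2 ^ p * (I.toReal + 1) * d ^ (-(2 * s))) := by
        rw [← ENNReal.ofReal_mul (by positivity), ← ENNReal.ofReal_mul (by positivity)]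
        congr 1
        have : d ^ (-(2 * s)) = d ^ (-p) * d ^ (n : ℝ) := by
          rw [← Real.rpow_add hd]
          congr 1
          rw [hp]; ring
        rw [this]
        ring

/-- If `d x` bounds from below the distance of `x ∈ A` to `B`, the interaction of `A` and `B`
is controlled by the integral of `d^{-2s}`. -/
theorem lintegral_prod_fracKernel_le {n : ℕ} {s T : ℝ}
    (hT : ∀ (x : EuclideanSpace ℝ (Fin n)) (d : ℝ), 0 < d →
      ∫⁻ y in {y | d ≤ dist x y}, fracKernel n s (x, y) ≤ ENNReal.ofReal (T * d ^ (-(2 * s))))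
    {A B : Set (EuclideanSpace ℝ (Fin n))} (hA : MeasurableSet A)
    {d : EuclideanSpace ℝ (Fin n) → ℝ} (hd : ∀ x ∈ A, 0 < d x)
    (hAB : ∀ x ∈ A, ∀ y ∈ B, d x ≤ dist x y) :
    ∫⁻ z in A ×ˢ B, fracKernel n s z ≤ ∫⁻ x in A, ENNReal.ofReal (T * d x ^ (-(2 * s))) := by
  rw [Measure.volume_eq_prod, ← Measure.prod_restrict]
  refine (lintegral_prod_le _).trans (setLIntegral_mono' hA fun x hx => ?_)
  exact (lintegral_mono_set fun y hy => hAB x hx y hy).trans (hT x (d x) (hd x hx))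

/-- Interaction of two sets at distance at least `d`. -/
theorem lintegral_prod_fracKernel_le_volume {n : ℕ} {s T : ℝ}
    (hT : ∀ (x : EuclideanSpace ℝ (Fin n)) (d : ℝ), 0 < d →
      ∫⁻ y in {y | d ≤ dist x y}, fracKernel n s (x, y) ≤ ENNReal.ofReal (T * d ^ (-(2 * s))))
    {A B : Set (EuclideanSpace ℝ (Fin n))} (hA : MeasurableSet A) {d : ℝ} (hd : 0 < d)
    (hAB : ∀ x ∈ A, ∀ y ∈ B, d ≤ dist x y) :
    ∫⁻ z in A ×ˢ B, fracKernel n s z ≤ ENNReal.ofReal (T * d ^ (-(2 * s))) * volume A := by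
  simpa using lintegral_prod_fracKernel_le hT hA (d := fun _ => d) (fun _ _ => hd) hAB

/-- If `f` grows at unit speed in the unit direction `e`, the integral of `w ∘ f` over a ball is
controlled by the one-dimensional integral of `w`. -/
theorem lintegral_ball_comp_le {n : ℕ} {f : EuclideanSpace ℝ (Fin n) → ℝ} (hf : Measurable f)
    {e : EuclideanSpace ℝ (Fin n)} (he : ‖e‖ = 1) (hfe : ∀ x (t : ℝ), f (x + t • e) = f x + t)
    {w : ℝ → ℝ≥0∞} (hw : Measurable w) (x₀ : EuclideanSpace ℝ (Fin n)) (r : ℝ) :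
    ∫⁻ x in ball x₀ r, w (f x) ≤ volume (ball x₀ (r + 1)) * ∫⁻ t, w t := by
  have hshift : ∀ t ∈ Icc (0 : ℝ) 1,
      ∫⁻ x in ball x₀ r, w (f x) ≤ ∫⁻ x in ball x₀ (r + 1), w (f x + t) := by
    intro t ht
    rw [← lintegral_indicator measurableSet_ball, ← lintegral_indicator measurableSet_ball,
      ← lintegral_add_right_eq_self _ (t • e)]
    refine lintegral_mono fun x => ?_
    by_cases hx : x + t • e ∈ ball x₀ r
    · have hx' : x ∈ ball x₀ (r + 1) := by
        have h1 : dist x (x + t • e) ≤ 1 := by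
          simpa [dist_eq_norm, norm_smul, he, abs_of_nonneg ht.1] using ht.2
        rw [mem_ball] at hx ⊢
        linarith [dist_triangle x (x + t • e) x₀]
      simp [hx, hx', hfe]
    · simp [hx]
  calc ∫⁻ x in ball x₀ r, w (f x)
      = ∫⁻ _t in Icc (0 : ℝ) 1, ∫⁻ x in ball x₀ r, w (f x) := by simp
    _ ≤ ∫⁻ t in Icc (0 : ℝ) 1, ∫⁻ x in ball x₀ (r + 1), w (f x + t) :=
        setLIntegral_mono' measurableSet_Icc hshift
    _ = ∫⁻ x in ball x₀ (r + 1), ∫⁻ t in Icc (0 : ℝ) 1, w (f x + t) :=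
        lintegral_lintegral_swap (by
          unfold Function.uncurry
          fun_prop)
    _ ≤ ∫⁻ _x in ball x₀ (r + 1), ∫⁻ t, w t := lintegral_mono fun x =>
        (setLIntegral_le_lintegral _ _).trans (lintegral_add_left_eq_self w (f x)).le
    _ = volume (ball x₀ (r + 1)) * ∫⁻ t, w t := by simp [mul_comm]

theorem lintegral_indicator_Ioo_rpow_lt_top {s : ℝ} (hs' : s < 1 / 2) :
    ∫⁻ t, (Ioo (0 : ℝ) 1).indicator (fun t => ENNReal.ofReal (t ^ (-(2 * s)))) t < ∞ := by
  rw [lintegral_indicator measurableSet_Ioo]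
  exact ((intervalIntegral.integrableOn_Ioo_rpow_iff one_pos).2 (by linarith)).lintegral_lt_top

/-- Near a boundary point, a Lipschitz epigraph has finite interaction with its complement. -/
theorem lintegral_ball_inter_prod_compl_lt_top {n : ℕ} {s : ℝ} (hs : 0 < s) (hs' : s < 1 / 2)
    {Ω : Set (EuclideanSpace ℝ (Fin n))} (hΩ : IsOpen Ω) {x₀ e : EuclideanSpace ℝ (Fin n)}
    {r L : ℝ} (hr : 0 < r) (hL : 0 < L) (he : ‖e‖ = 1) {ψ : EuclideanSpace ℝ (Fin n) → ℝ}
    (hψ : ∀ x y, |ψ x - ψ y| ≤ L * ‖x - y‖)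
    (hgraph : Ω ∩ ball x₀ r = {y ∈ ball x₀ r | ψ (y - ⟪y, e⟫ • e) < ⟪y, e⟫}) :
    ∫⁻ z in (ball x₀ (r / 2) ∩ Ω) ×ˢ Ωᶜ, fracKernel n s z < ∞ := by
  obtain ⟨T, hT0, hT⟩ := exists_lintegral_fracKernel_le n hs
  have hψc : Continuous ψ := by
    refine (LipschitzWith.of_dist_le_mul (K := ⟨L, hL.le⟩) fun x y => ?_).continuous
    rw [Real.dist_eq, dist_eq_norm]
    exact hψ x y
  set f : EuclideanSpace ℝ (Fin n) → ℝ := fun y => ⟪y, e⟫ - ψ (y - ⟪y, e⟫ • e) with hf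
  have hfm : Continuous f := by fun_prop
  have hfe : ∀ x (t : ℝ), f (x + t • e) = f x + t := by
    intro x t
    have h1 : ⟪x + t • e, e⟫ = ⟪x, e⟫ + t := by
      rw [inner_add_left, real_inner_smul_left, real_inner_self_eq_norm_sq, he]
      ring
    have h2 : x + t • e - (⟪x, e⟫ + t) • e = x - ⟪x, e⟫ • e := by module
    simp only [hf, h1, h2]
    ring
  have hflip : ∀ x y, f x - f y ≤ (1 + 2 * L) * ‖x - y‖ := by
    intro x y
    have h1 : |⟪x, e⟫ - ⟪y, e⟫| ≤ ‖x - y‖ := by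
      rw [← inner_sub_left]
      simpa [he] using abs_real_inner_le_norm (x - y) e
    have h2 : ‖(x - ⟪x, e⟫ • e) - (y - ⟪y, e⟫ • e)‖ ≤ 2 * ‖x - y‖ := by
      have : (x - ⟪x, e⟫ • e) - (y - ⟪y, e⟫ • e) = (x - y) - (⟪x, e⟫ - ⟪y, e⟫) • e := by module
      rw [this]
      refine (norm_sub_le _ _).trans ?_
      rw [norm_smul, he, Real.norm_eq_abs]
      linarith
    have h3 := (abs_le.1 (hψ (x - ⟪x, e⟫ • e) (y - ⟪y, e⟫ • e))).1
    have h4 := mul_le_mul_of_nonneg_left h2 hL.le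
    simp only [hf]
    linarith [(abs_le.1 h1).2]
  set c : ℝ := min (1 / (1 + 2 * L)) (r / 2) with hc
  have hc0 : 0 < c := by positivity
  have hcL : c * (1 + 2 * L) ≤ 1 := by
    rw [← le_div_iff₀ (by positivity)]
    exact min_le_left _ _
  have hcr : c ≤ r / 2 := min_le_right _ _
  have hball : ball x₀ (r / 2) ⊆ ball x₀ r := ball_subset_ball (by linarith)
  have hpos : ∀ x ∈ ball x₀ (r / 2) ∩ Ω, 0 < f x := by
    intro x hx
    have : x ∈ Ω ∩ ball x₀ r := ⟨hx.2, hball hx.1⟩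
    rw [hgraph] at this
    exact sub_pos.2 this.2
  have hdist : ∀ x ∈ ball x₀ (r / 2) ∩ Ω, ∀ y ∈ Ωᶜ, c * min (f x) 1 ≤ dist x y := by
    intro x hx y hy
    by_cases hyr : y ∈ ball x₀ r
    · have hfy : f y ≤ 0 := by
        by_contra! h
        have : y ∈ Ω ∩ ball x₀ r := by
          rw [hgraph]
          exact ⟨hyr, sub_pos.1 h⟩
        exact hy this.1
      rw [dist_eq_norm]
      calc c * min (f x) 1 ≤ c * ((1 + 2 * L) * ‖x - y‖) := by
            gcongr
            exact (min_le_left _ _).trans (by linarith [hflip x y])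
        _ = c * (1 + 2 * L) * ‖x - y‖ := by ring
        _ ≤ 1 * ‖x - y‖ := by gcongr
        _ = ‖x - y‖ := one_mul _
    · have h1 : c * min (f x) 1 ≤ c * 1 := by
        gcongr
        exact min_le_right _ _
      rw [mem_ball, not_lt] at hyr
      have h2 := mem_ball.1 hx.1
      linarith [dist_triangle_left y x₀ x]
  set w : ℝ → ℝ≥0∞ := (Ioo (0 : ℝ) 1).indicator (fun t => ENNReal.ofReal (t ^ (-(2 * s))))
    with hw
  have hwm : Measurable w := Measurable.indicator (by fun_prop) measurableSet_Ioo
  refine (lintegral_prod_fracKernel_le hT (measurableSet_ball.inter hΩ.measurableSet)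
    (d := fun x => c * min (f x) 1)
    (fun x hx => mul_pos hc0 (lt_min (hpos x hx) one_pos)) hdist).trans_lt ?_
  have hpt : ∀ x ∈ ball x₀ (r / 2) ∩ Ω, ENNReal.ofReal (T * (c * min (f x) 1) ^ (-(2 * s))) ≤
      ENNReal.ofReal (T * c ^ (-(2 * s))) * (w (f x) + 1) := by
    intro x hx
    have hfx := hpos x hx
    rw [Real.mul_rpow hc0.le (lt_min hfx one_pos).le, ← mul_assoc,
      ENNReal.ofReal_mul (by positivity)]
    gcongr
    rcases lt_or_ge (f x) 1 with h | h
    · rw [hw, indicator_of_mem (show f x ∈ Ioo (0 : ℝ) 1 from ⟨hfx, h⟩), min_eq_left h.le]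
      exact le_self_add
    · rw [min_eq_right h]
      simp
  refine (setLIntegral_mono (by fun_prop) hpt).trans_lt ?_
  refine (lintegral_mono_set inter_subset_left).trans_lt ?_
  rw [lintegral_const_mul _ (by fun_prop), lintegral_add_right _ measurable_const]
  refine ENNReal.mul_lt_top ENNReal.ofReal_lt_top (ENNReal.add_lt_top.2 ⟨?_, ?_⟩)
  · exact (lintegral_ball_comp_le hfm.measurable he hfe hwm x₀ (r / 2)).trans_lt
      (ENNReal.mul_lt_top measure_ball_lt_top (lintegral_indicator_Ioo_rpow_lt_top hs'))
  · simpa using measure_ball_lt_top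

/-- A bounded Lipschitz domain has finite `s`-perimeter for `s < 1/2`. -/
theorem lintegral_prod_compl_lt_top {n : ℕ} {s : ℝ} (hs : 0 < s) (hs' : s < 1 / 2)
    {Ω : Set (EuclideanSpace ℝ (Fin n))} (hΩ : IsOpen Ω) (hb : Bornology.IsBounded Ω)
    (hlip : HasLipschitzBoundary n Ω) :
    ∫⁻ z in Ω ×ˢ Ωᶜ, fracKernel n s z < ∞ := by
  obtain ⟨T, hT0, hT⟩ := exists_lintegral_fracKernel_le n hs
  have key := hb.isCompact_closure.induction_on
    (p := fun S => ∫⁻ z in (S ∩ Ω) ×ˢ Ωᶜ, fracKernel n s z < ∞) (by simp)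
    (fun S S' hSS h => (lintegral_mono_set
      (prod_mono_left (inter_subset_inter_left _ hSS))).trans_lt h)
    (fun S S' h h' => by
      rw [union_inter_distrib_right, union_prod]
      exact (lintegral_union_le _ _ _).trans_lt (ENNReal.add_lt_top.2 ⟨h, h'⟩))
    (fun x hx => by
      by_cases hxΩ : x ∈ Ω
      · obtain ⟨r, hr, hrΩ⟩ := Metric.isOpen_iff.1 hΩ x hxΩ
        refine ⟨ball x (r / 2), mem_nhdsWithin_of_mem_nhds (ball_mem_nhds x (by positivity)), ?_⟩
        refine (lintegral_prod_fracKernel_le_volume hT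
          (measurableSet_ball.inter hΩ.measurableSet) (half_pos hr) ?_).trans_lt
          (ENNReal.mul_lt_top ENNReal.ofReal_lt_top
            ((measure_mono inter_subset_left).trans_lt measure_ball_lt_top))
        intro y hy z hz
        by_contra! h
        refine hz (hrΩ ?_)
        have := mem_ball.1 hy.1
        rw [mem_ball]
        linarith [dist_triangle_left z x y]
      · obtain ⟨r, hr, L, hL, e, he, ψ, hψ, hgraph⟩ := hlip x
          (hΩ.frontier_eq ▸ ⟨hx, hxΩ⟩)
        exact ⟨ball x (r / 2), mem_nhdsWithin_of_mem_nhds (ball_mem_nhds x (by positivity)),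
          lintegral_ball_inter_prod_compl_lt_top hs hs' hΩ hr hL he hψ hgraph⟩)
  rwa [inter_eq_self_of_subset_right subset_closure] at key

theorem measurable_pm {n : ℕ} {E : Set (EuclideanSpace ℝ (Fin n))} (hE : MeasurableSet E) :
    Measurable (pm n E) :=
  (measurable_const.indicator hE).sub (measurable_const.indicator hE.compl)

theorem pm_congr {n : ℕ} {E F : Set (EuclideanSpace ℝ (Fin n))} {x : EuclideanSpace ℝ (Fin n)}
    (h : x ∈ F ↔ x ∈ E) : pm n F x = pm n E x := by
  by_cases hx : x ∈ E <;> simp [pm, h, hx]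

theorem pm_eq_one_or_neg_one {n : ℕ} (E : Set (EuclideanSpace ℝ (Fin n)))
    (x : EuclideanSpace ℝ (Fin n)) : pm n E x = 1 ∨ pm n E x = -1 := by
  by_cases hx : x ∈ E <;> simp [pm, hx]

theorem ofReal_sq_abs_pm_sub_pm {n : ℕ} (E : Set (EuclideanSpace ℝ (Fin n)))
    (x y : EuclideanSpace ℝ (Fin n)) :
    ENNReal.ofReal (|pm n E x - pm n E y| ^ 2) = {z : _ × _ | ¬(z.1 ∈ E ↔ z.2 ∈ E)}.indicator
      (fun _ => (4 : ℝ≥0∞)) (x, y) := by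
  by_cases hx : x ∈ E <;> by_cases hy : y ∈ E <;> simp [pm, hx, hy] <;> norm_num

theorem ofReal_sq_abs_pm_sub_le {n : ℕ} (E : Set (EuclideanSpace ℝ (Fin n)))
    (x : EuclideanSpace ℝ (Fin n)) {a : ℝ} (ha : a ∈ Icc (-1 : ℝ) 1) :
    ENNReal.ofReal (|pm n E x - a| ^ 2) ≤ 4 := by
  rw [← ENNReal.ofReal_ofNat]
  refine ENNReal.ofReal_le_ofReal ?_
  rw [sq_abs]
  rcases pm_eq_one_or_neg_one E x with h | h <;> rw [h] <;> nlinarith [ha.1, ha.2]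

theorem ofReal_div_rpow_eq_mul_fracKernel {n : ℕ} {s a : ℝ} (ha : 0 ≤ a)
    (z : EuclideanSpace ℝ (Fin n) × EuclideanSpace ℝ (Fin n)) :
    ENNReal.ofReal (a / ‖z.1 - z.2‖ ^ ((n : ℝ) + 2 * s)) =
      ENNReal.ofReal a * fracKernel n s z := by
  rw [fracKernel, ← ENNReal.ofReal_mul ha, div_eq_mul_inv, ← Real.rpow_neg (norm_nonneg _)]
  congr 3
  ring

theorem lintegral_indicator_mul {α : Type*} [MeasurableSpace α] {μ : Measure α} {A : Set α}
    (hA : MeasurableSet A) (c k : α → ℝ≥0∞) :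
    ∫⁻ z, A.indicator c z * k z ∂μ = ∫⁻ z in A, c z * k z ∂μ := by
  rw [← lintegral_indicator hA]
  simp only [indicator_mul_left]

/-- Pairs of points separated by `E`, at least one of which lies in `O`. -/
def separatedPairs {n : ℕ} (E O : Set (EuclideanSpace ℝ (Fin n))) :
    Set (EuclideanSpace ℝ (Fin n) × EuclideanSpace ℝ (Fin n)) :=
  {z | ¬(z.1 ∈ E ↔ z.2 ∈ E) ∧ (z.1 ∈ O ∨ z.2 ∈ O)}

theorem measurableSet_separatedPairs {n : ℕ} {E O : Set (EuclideanSpace ℝ (Fin n))}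
    (hE : MeasurableSet E) (hO : MeasurableSet O) : MeasurableSet (separatedPairs E O) :=
  (((measurable_fst hE).iff (measurable_snd hE)).compl).inter
    ((measurable_fst hO).union (measurable_snd hO))

theorem setLIntegral_fracKernel_swap_preimage {n : ℕ} {s : ℝ}
    {S : Set (EuclideanSpace ℝ (Fin n) × EuclideanSpace ℝ (Fin n))} (hS : MeasurableSet S) :
    ∫⁻ z in Prod.swap ⁻¹' S, fracKernel n s z = ∫⁻ z in S, fracKernel n s z := by
  have h := (Measure.measurePreserving_swap (μ := (volume : Measure (EuclideanSpace ℝ (Fin n))))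
    (ν := (volume : Measure (EuclideanSpace ℝ (Fin n))))).setLIntegral_comp_preimage hS
    (measurable_fracKernel n s)
  simpa only [fracKernel_swap, ← Measure.volume_eq_prod] using h

theorem two_mul_fracPer {n : ℕ} {s : ℝ} {E O : Set (EuclideanSpace ℝ (Fin n))}
    (hE : MeasurableSet E) (hO : MeasurableSet O) :
    2 * fracPer n s E O = ∫⁻ z in separatedPairs E O, fracKernel n s z := by
  set S := (E ∩ O) ×ˢ Eᶜ ∪ (E \ O) ×ˢ (Eᶜ ∩ O) with hS
  have hm : MeasurableSet ((E \ O) ×ˢ (Eᶜ ∩ O)) := (hE.diff hO).prod (hE.compl.inter hO)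
  have hSm : MeasurableSet S := ((hE.inter hO).prod hE.compl).union hm
  have hper : fracPer n s E O = ∫⁻ z in S, fracKernel n s z := by
    rw [hS, lintegral_union hm]
    · rfl
    · exact Disjoint.set_prod_left (disjoint_sdiff_right.mono_left inter_subset_right) _ _
  have hsplit : separatedPairs E O = S ∪ Prod.swap ⁻¹' S := by
    ext z
    simp only [separatedPairs, hS, mem_ofPred_eq, mem_union, mem_preimage, mem_prod, mem_inter_iff,
      Set.mem_sdiff, mem_compl_iff, Prod.fst_swap, Prod.snd_swap]
    tauto
  have hdisj : Disjoint S (Prod.swap ⁻¹' S) := by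
    rw [Set.disjoint_left]
    simp only [hS, mem_union, mem_preimage, mem_prod, mem_inter_iff,
      Set.mem_sdiff, mem_compl_iff, Prod.fst_swap, Prod.snd_swap]
    tauto
  rw [hsplit, lintegral_union (measurable_swap hSm) hdisj,
    setLIntegral_fracKernel_swap_preimage hSm, hper, two_mul]

/-- The density of `H(E,Ω)` with respect to the kernel. -/
def HDensity {n : ℕ} (Ω : Set (EuclideanSpace ℝ (Fin n))) (g : EuclideanSpace ℝ (Fin n) → ℝ)
    (E : Set (EuclideanSpace ℝ (Fin n)))
    (z : EuclideanSpace ℝ (Fin n) × EuclideanSpace ℝ (Fin n)) : ℝ≥0∞ :=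
  (Ω ×ˢ Ω).indicator (fun z => ENNReal.ofReal (|pm n E z.1 - pm n E z.2| ^ 2)) z +
    2 * (Ω ×ˢ Ωᶜ).indicator (fun z => ENNReal.ofReal (|pm n E z.1 - g z.2| ^ 2)) z

theorem Hfun_eq_lintegral {n : ℕ} {s : ℝ} {Ω E : Set (EuclideanSpace ℝ (Fin n))}
    {g : EuclideanSpace ℝ (Fin n) → ℝ} (hΩ : MeasurableSet Ω) (hE : MeasurableSet E) :
    Hfun n s Ω g E = ∫⁻ z, HDensity Ω g E z * fracKernel n s z := by
  have hpm := measurable_pm hE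
  have hm : Measurable fun z => (Ω ×ˢ Ω).indicator
      (fun z => ENNReal.ofReal (|pm n E z.1 - pm n E z.2| ^ 2)) z * fracKernel n s z :=
    (Measurable.indicator (by fun_prop) (hΩ.prod hΩ)).mul (measurable_fracKernel n s)
  simp only [HDensity, add_mul, mul_assoc]
  rw [lintegral_add_left hm, lintegral_const_mul' _ _ (by norm_num),
    lintegral_indicator_mul (hΩ.prod hΩ), lintegral_indicator_mul (hΩ.prod hΩ.compl)]
  simp only [Hfun, ofReal_div_rpow_eq_mul_fracKernel (sq_nonneg _)]

theorem Hfun_empty_lt_top {n : ℕ} {s : ℝ} {Ω : Set (EuclideanSpace ℝ (Fin n))}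
    {g : EuclideanSpace ℝ (Fin n) → ℝ} (hg : ∀ x, g x ∈ Icc (-1 : ℝ) 1)
    (hΩ : ∫⁻ z in Ω ×ˢ Ωᶜ, fracKernel n s z < ∞) : Hfun n s Ω g ∅ < ∞ := by
  simp only [Hfun, ofReal_div_rpow_eq_mul_fracKernel (sq_nonneg _)]
  refine ENNReal.add_lt_top.2 ⟨by simp [pm], ENNReal.mul_lt_top (by norm_num) ?_⟩
  calc ∫⁻ z in Ω ×ˢ Ωᶜ, ENNReal.ofReal (|pm n ∅ z.1 - g z.2| ^ 2) * fracKernel n s z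
      ≤ ∫⁻ z in Ω ×ˢ Ωᶜ, 4 * fracKernel n s z := lintegral_mono fun z =>
        mul_le_mul_left (ofReal_sq_abs_pm_sub_le ∅ z.1 (hg z.2)) _
    _ = 4 * ∫⁻ z in Ω ×ˢ Ωᶜ, fracKernel n s z := lintegral_const_mul' _ _ (by norm_num)
    _ < ∞ := ENNReal.mul_lt_top (by norm_num) hΩ

/-- Pointwise comparison of the densities of `8 Per_s(·,O) + H(·,Ω)`. -/
theorem density_le {n : ℕ} {Ω O E F : Set (EuclideanSpace ℝ (Fin n))}
    {g : EuclideanSpace ℝ (Fin n) → ℝ} (hO : O ⊆ Ω) (hg : ∀ x, g x ∈ Icc (-1 : ℝ) 1)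
    {z : EuclideanSpace ℝ (Fin n) × EuclideanSpace ℝ (Fin n)}
    (hx : z.1 ∉ O → (z.1 ∈ F ↔ z.1 ∈ E)) (hy : z.2 ∉ O → (z.2 ∈ F ↔ z.2 ∈ E)) :
    (separatedPairs E O).indicator (fun _ => 4) z + HDensity Ω g F z ≤
      (separatedPairs F O).indicator (fun _ => 4) z + HDensity Ω g E z +
        ((((E ∆ F) ∩ O) ×ˢ Ωᶜ).indicator (fun _ => 12) z +
          (Prod.swap ⁻¹' (((E ∆ F) ∩ O) ×ˢ Ωᶜ)).indicator (fun _ => 4) z) := by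
  obtain ⟨x, y⟩ := z
  simp only at hx hy
  by_cases hxΩ : x ∈ Ω <;> by_cases hyΩ : y ∈ Ω
  · refine le_add_right (le_of_eq ?_)
    simp only [HDensity, ofReal_sq_abs_pm_sub_pm]
    by_cases h : x ∈ O ∨ y ∈ O
    · by_cases hE : x ∈ E ↔ y ∈ E <;> by_cases hF : x ∈ F ↔ y ∈ F <;>
        simp [separatedPairs, hxΩ, hyΩ, h, hE, hF]
    · have hFE : (x ∈ F ↔ y ∈ F) ↔ (x ∈ E ↔ y ∈ E) := by
        rw [hx fun h' => h (.inl h'), hy fun h' => h (.inr h')]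
      by_cases hE : x ∈ E ↔ y ∈ E <;> simp [separatedPairs, hxΩ, hyΩ, h, hFE, hE]
  · have hyO : y ∉ O := fun h => hyΩ (hO h)
    by_cases hD : x ∈ F ↔ x ∈ E
    · refine le_add_right (le_of_eq ?_)
      have hFE : (x ∈ F ↔ y ∈ F) ↔ (x ∈ E ↔ y ∈ E) := by rw [hD, hy hyO]
      by_cases hE : ¬(x ∈ E ↔ y ∈ E) ∧ (x ∈ O ∨ y ∈ O) <;>
        simp [separatedPairs, HDensity, hFE, hE, pm_congr hD, hxΩ, hyΩ]
    · have hxO : x ∈ O := by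
        by_contra h
        exact hD (hx h)
      have hmem : (x, y) ∈ ((E ∆ F) ∩ O) ×ˢ Ωᶜ := by
        refine ⟨⟨?_, hxO⟩, hyΩ⟩
        rw [mem_symmDiff]
        tauto
      rw [indicator_of_mem hmem]
      refine le_trans ?_ (le_add_left (le_add_right le_rfl))
      calc _ ≤ (4 : ℝ≥0∞) + 2 * 4 := by
            refine add_le_add (indicator_le_self' (by simp) _) ?_
            simpa [HDensity, hxΩ, hyΩ] using
              mul_le_mul_right (ofReal_sq_abs_pm_sub_le F x (hg y)) 2
        _ = 12 := by norm_num
  · have hxO : x ∉ O := fun h => hxΩ (hO h)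
    by_cases hD : y ∈ F ↔ y ∈ E
    · refine le_add_right (le_of_eq ?_)
      have hFE : (x ∈ F ↔ y ∈ F) ↔ (x ∈ E ↔ y ∈ E) := by rw [hD, hx hxO]
      by_cases hE : ¬(x ∈ E ↔ y ∈ E) ∧ (x ∈ O ∨ y ∈ O) <;>
        simp [separatedPairs, HDensity, hFE, hE, hxΩ]
    · have hyO : y ∈ O := by
        by_contra h
        exact hD (hy h)
      have hmem : (x, y) ∈ Prod.swap ⁻¹' (((E ∆ F) ∩ O) ×ˢ Ωᶜ) := by
        refine ⟨⟨?_, hyO⟩, hxΩ⟩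
        change y ∈ E ∆ F
        rw [mem_symmDiff]
        tauto
      rw [indicator_of_mem hmem]
      refine le_trans ?_ (le_add_left (le_add_left le_rfl))
      have h0 : HDensity Ω g F (x, y) = 0 := by simp [HDensity, hxΩ]
      rw [h0, add_zero]
      exact indicator_le_self' (by simp) _
  · have hxO : x ∉ O := fun h => hxΩ (hO h)
    have hyO : y ∉ O := fun h => hyΩ (hO h)
    simp [separatedPairs, HDensity, hxΩ, hxO, hyO]

theorem fracPer_add_Hfun_le {n : ℕ} {s : ℝ} {Ω O E F : Set (EuclideanSpace ℝ (Fin n))}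
    {g : EuclideanSpace ℝ (Fin n) → ℝ} (hOΩ : O ⊆ Ω) (hΩ : MeasurableSet Ω)
    (hO : MeasurableSet O) (hgm : Measurable g) (hg : ∀ x, g x ∈ Icc (-1 : ℝ) 1)
    (hE : MeasurableSet E) (hF : MeasurableSet F) (hFE : ∀ᵐ x, x ∉ O → (x ∈ F ↔ x ∈ E)) :
    8 * fracPer n s E O + Hfun n s Ω g F ≤ 8 * fracPer n s F O + Hfun n s Ω g E +
      16 * ∫⁻ z in ((E ∆ F) ∩ O) ×ˢ Ωᶜ, fracKernel n s z := by
  have hper : ∀ {G : Set (EuclideanSpace ℝ (Fin n))}, MeasurableSet G →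
      8 * fracPer n s G O =
        ∫⁻ z, (separatedPairs G O).indicator (fun _ => 4) z * fracKernel n s z := by
    intro G hG
    rw [lintegral_indicator_mul (measurableSet_separatedPairs hG hO),
      lintegral_const_mul' _ _ (by norm_num), ← two_mul_fracPer hG hO, ← mul_assoc]
    norm_num
  have hDm : MeasurableSet (((E ∆ F) ∩ O) ×ˢ Ωᶜ) := ((hE.symmDiff hF).inter hO).prod hΩ.compl
  have herr : 16 * ∫⁻ z in ((E ∆ F) ∩ O) ×ˢ Ωᶜ, fracKernel n s z =
      ∫⁻ z, ((((E ∆ F) ∩ O) ×ˢ Ωᶜ).indicator (fun _ => 12) z +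
          (Prod.swap ⁻¹' (((E ∆ F) ∩ O) ×ˢ Ωᶜ)).indicator (fun _ => 4) z) * fracKernel n s z := by
    have hm : Measurable fun z => (((E ∆ F) ∩ O) ×ˢ Ωᶜ).indicator (fun _ => (12 : ℝ≥0∞)) z *
        fracKernel n s z :=
      (measurable_const.indicator hDm).mul (measurable_fracKernel n s)
    simp only [add_mul]
    rw [lintegral_add_left hm,
      lintegral_indicator_mul hDm, lintegral_indicator_mul (measurable_swap hDm),
      lintegral_const_mul' _ _ (by norm_num), lintegral_const_mul' _ _ (by norm_num),
      setLIntegral_fracKernel_swap_preimage hDm, ← add_mul]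
    norm_num
  have hsep : ∀ {G : Set (EuclideanSpace ℝ (Fin n))}, MeasurableSet G → Measurable fun z =>
      (separatedPairs G O).indicator (fun _ => (4 : ℝ≥0∞)) z * fracKernel n s z := fun hG =>
    (measurable_const.indicator (measurableSet_separatedPairs hG hO)).mul
      (measurable_fracKernel n s)
  have hH : Measurable fun z => HDensity Ω g E z * fracKernel n s z := by
    have hpm := measurable_pm hE
    exact ((Measurable.indicator (by fun_prop) (hΩ.prod hΩ)).add
      ((Measurable.indicator (by fun_prop) (hΩ.prod hΩ.compl)).const_mul 2)).mul
      (measurable_fracKernel n s)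
  have hsum : Measurable fun z => (separatedPairs F O).indicator (fun _ => (4 : ℝ≥0∞)) z *
      fracKernel n s z + HDensity Ω g E z * fracKernel n s z := (hsep hF).add hH
  rw [hper hE, hper hF, Hfun_eq_lintegral hΩ hE, Hfun_eq_lintegral hΩ hF, herr,
    ← lintegral_add_left (hsep hE), ← lintegral_add_left (hsep hF),
    ← lintegral_add_left hsum]
  have h1 : ∀ᵐ z : EuclideanSpace ℝ (Fin n) × EuclideanSpace ℝ (Fin n),
      z.1 ∉ O → (z.1 ∈ F ↔ z.1 ∈ E) := Measure.quasiMeasurePreserving_fst.ae hFE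
  have h2 : ∀ᵐ z : EuclideanSpace ℝ (Fin n) × EuclideanSpace ℝ (Fin n),
      z.2 ∉ O → (z.2 ∈ F ↔ z.2 ∈ E) := Measure.quasiMeasurePreserving_snd.ae hFE
  refine lintegral_mono_ae ?_
  filter_upwards [h1, h2] with z hz1 hz2
  simp only [← add_mul]
  exact mul_le_mul_left (density_le hOΩ hg hz1 hz2) _

/-- Proposition 2.1: there is a constant `C > 0`, depending only on `n`
and `s`, such that whenever `Ω' ⋐ Ω`, `ρ > 0` is (a lower bound for) the distance between
`Ω'` and `ℝⁿ \ Ω`, and `E` minimizes `H(·,Ω)`, then for every measurable `F` with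
`F \ Ω' = E \ Ω'` (up to a null set) one has
`Per_s(E,Ω') ≤ Per_s(F,Ω') + C ρ^{-2s} |E Δ F|`;
that is, `E` is an almost minimizer of the fractional `s`-perimeter in `Ω'` with
constant `Λ = C ρ^{-2s}`. -/
theorem statement3
    (n : ℕ) (hn : 1 ≤ n) (s : ℝ) (hs : 0 < s) (hs' : s < 1 / 2) :
    ∃ C > (0 : ℝ),
      ∀ Ω : Set (EuclideanSpace ℝ (Fin n)), IsOpen Ω → Bornology.IsBounded Ω →
        HasLipschitzBoundary n Ω →
      ∀ g : EuclideanSpace ℝ (Fin n) → ℝ, Continuous g → (∀ x, g x ∈ Icc (-1 : ℝ) 1) →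
      ∀ Ω' : Set (EuclideanSpace ℝ (Fin n)), IsOpen Ω' → closure Ω' ⊆ Ω →
        IsCompact (closure Ω') →
      ∀ ρ : ℝ, 0 < ρ → (∀ x ∈ Ω', ∀ y ∉ Ω, ρ ≤ dist x y) →
      ∀ E : Set (EuclideanSpace ℝ (Fin n)), MeasurableSet E →
        (∀ F : Set (EuclideanSpace ℝ (Fin n)), MeasurableSet F →
          Hfun n s Ω g E ≤ Hfun n s Ω g F) →
      ∀ F : Set (EuclideanSpace ℝ (Fin n)), MeasurableSet F →
        volume ((F \ Ω') ∆ (E \ Ω')) = 0 →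
        fracPer n s E Ω' ≤ fracPer n s F Ω' +
          ENNReal.ofReal (C * ρ ^ (-(2 * s))) * volume (E ∆ F) := by
  obtain ⟨T, hT0, hT⟩ := exists_lintegral_fracKernel_le n hs
  refine ⟨2 * T, by positivity, fun Ω hΩ hb hlip g hg hg1 Ω' hΩ' hcl _ ρ hρ hdist E hE hmin F hF
    hFE => ?_⟩
  have hsub : Ω' ⊆ Ω := subset_closure.trans hcl
  set J : ℝ≥0∞ := ∫⁻ z in ((E ∆ F) ∩ Ω') ×ˢ Ωᶜ, fracKernel n s z
  have hJ : J ≤ ENNReal.ofReal (T * ρ ^ (-(2 * s))) * volume (E ∆ F) := by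
    refine (lintegral_prod_fracKernel_le_volume hT
      ((hE.symmDiff hF).inter hΩ'.measurableSet) hρ fun x hx y hy => hdist x hx.2 y hy).trans ?_
    gcongr
    exact inter_subset_left
  have hfin : Hfun n s Ω g E ≠ ∞ := ((hmin ∅ .empty).trans_lt
    (Hfun_empty_lt_top hg1 (lintegral_prod_compl_lt_top hs hs' hΩ hb hlip))).ne
  have hae : ∀ᵐ x, x ∉ Ω' → (x ∈ F ↔ x ∈ E) := by
    filter_upwards [measure_symmDiff_eq_zero_iff.1 hFE |>.mem_iff] with x hx hxΩ
    simpa [hxΩ] using hx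
  have hcomp := fracPer_add_Hfun_le (s := s) hsub hΩ.measurableSet hΩ'.measurableSet
    hg.measurable hg1 hE hF hae
  have h8 : 8 * fracPer n s E Ω' ≤ 8 * fracPer n s F Ω' + 16 * J := by
    refine (ENNReal.add_le_add_iff_right hfin).1 ?_
    calc 8 * fracPer n s E Ω' + Hfun n s Ω g E
        ≤ 8 * fracPer n s E Ω' + Hfun n s Ω g F := by gcongr; exact hmin F hF
      _ ≤ _ := hcomp
      _ = _ := by ring
  have h2 : fracPer n s E Ω' ≤ fracPer n s F Ω' + 2 * J := by
    refine (ENNReal.mul_le_mul_iff_right (a := 8) (by norm_num) (by norm_num)).1 (h8.trans_eq ?_)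
    ring
  refine h2.trans ?_
  rw [mul_assoc 2 T, ENNReal.ofReal_mul zero_le_two, ENNReal.ofReal_ofNat, mul_assoc]
  gcongr
end
end

section
/- Let n ≥ 1, b > 0 and c ∈ (0,1/2). Let Ω ⊂ ℝⁿ be open and ū : ℝⁿ → [−1,1] measurable with ū(Q_Ω) < ∞. Then there exist ς > 0 and θ ∈ (0,b), depending only on n, s, b and c, such that the following holds. Assume there exist δ > 0 and points p, q ∈ ℝⁿ such that |p−q| < δ, B_{cδ}(p) ⊆ Ω, ū = −1 a.e. in B_{cδ}(p), and ū ≥ −1+b a.e. in B_{cδ}(q). Then the function u_δ defined by u_δ(x) = ū(x) for x ∈ ℝⁿ \ B_{cδ}(p) and u_δ(x) = −1+θ for x ∈ B_{cδ}(p) satisfies u_δ(Q_Ω) ≤ ū(Q_Ω) − ς δ^{n−2s}. -/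
open MeasureTheory Filter Set Metric
open scoped ENNReal NNReal Topology

noncomputable section

/-- The part of a ball that a translation by `z` moves out of the ball has measure at most
`r ^ d * min 1 (d * ‖z‖ / r)` times the measure of the unit ball. -/
lemma measure_ball_translate_compl_le {E : Type*} [NormedAddCommGroup E] [NormedSpace ℝ E]
    [FiniteDimensional ℝ E] [Nontrivial E] [MeasurableSpace E] [BorelSpace E]
    (μ : Measure E) [μ.IsAddHaarMeasure] (p z : E) {r : ℝ} (hr : 0 < r) :
    μ {x | x ∈ ball p r ∧ x + z ∉ ball p r} ≤
      ENNReal.ofReal (r ^ Module.finrank ℝ E * min 1 (Module.finrank ℝ E * (‖z‖ / r))) *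
        μ (ball 0 1) := by
  set d := Module.finrank ℝ E
  have hd : 1 ≤ d := Module.finrank_pos (R := ℝ) (M := E)
  have hd' : (1 : ℝ) ≤ d := by exact_mod_cast hd
  rcases le_total r ‖z‖ with hz | hz
  · have h1 : 1 ≤ ‖z‖ / r := (one_le_div hr).2 hz
    rw [min_eq_left (by nlinarith), mul_one, ← Measure.addHaar_ball μ p hr.le]
    exact measure_mono fun x hx => hx.1
  · have hsub : {x | x ∈ ball p r ∧ x + z ∉ ball p r} ⊆ ball p r \ ball p (r - ‖z‖) := by
      rintro x ⟨hx, hxz⟩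
      refine ⟨hx, fun h => hxz ?_⟩
      rw [mem_ball, dist_eq_norm] at h ⊢
      calc ‖x + z - p‖ = ‖(x - p) + z‖ := by congr 1; abel
        _ ≤ ‖x - p‖ + ‖z‖ := norm_add_le _ _
        _ < r := by linarith
    have hnn : 0 ≤ r - ‖z‖ := sub_nonneg.2 hz
    have hbern : r ^ d - (r - ‖z‖) ^ d ≤ r ^ d * min 1 (d * (‖z‖ / r)) := by
      have h1 : ‖z‖ / r ≤ 1 := (div_le_one hr).2 hz
      have h0 : 0 ≤ ‖z‖ / r := by positivity
      have h2 := one_add_mul_le_pow (a := -(‖z‖ / r)) (by linarith) d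
      have h3 : (r - ‖z‖) ^ d = r ^ d * (1 + -(‖z‖ / r)) ^ d := by
        rw [← mul_pow]; congr 1; field_simp; ring
      have h4 : 0 ≤ (1 + -(‖z‖ / r)) ^ d := pow_nonneg (by linarith) _
      rw [h3, ← mul_one_sub]
      refine mul_le_mul_of_nonneg_left (le_min ?_ ?_) (by positivity) <;> linarith
    calc μ {x | x ∈ ball p r ∧ x + z ∉ ball p r}
        ≤ μ (ball p r \ ball p (r - ‖z‖)) := measure_mono hsub
      _ = μ (ball p r) - μ (ball p (r - ‖z‖)) :=
          measure_sdiff (ball_subset_ball (by linarith [norm_nonneg z]))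
            measurableSet_ball.nullMeasurableSet measure_ball_lt_top.ne
      _ = ENNReal.ofReal (r ^ d - (r - ‖z‖) ^ d) * μ (ball 0 1) := by
          rw [Measure.addHaar_ball μ p hr.le, Measure.addHaar_ball μ p hnn,
            ENNReal.ofReal_sub _ (by positivity), ENNReal.sub_mul]
          intro _ _; exact measure_ball_lt_top.ne
      _ ≤ _ := by gcongr

/-- Integrability of the radial profile that dominates the fractional perimeter of a ball. -/
lemma integrable_min_div_norm_rpow {E : Type*} [NormedAddCommGroup E] [NormedSpace ℝ E]
    [FiniteDimensional ℝ E] [Nontrivial E] [MeasurableSpace E] [BorelSpace E]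
    (μ : Measure E) [μ.IsAddHaarMeasure] {s : ℝ} (hs : 0 < s) (hs' : s < 1 / 2) :
    Integrable (fun z : E => min 1 (Module.finrank ℝ E * ‖z‖) /
      ‖z‖ ^ ((Module.finrank ℝ E : ℝ) + 2 * s)) μ := by
  set d := Module.finrank ℝ E
  have hd : 1 ≤ d := Module.finrank_pos (R := ℝ) (M := E)
  rw [integrable_fun_norm_addHaar μ (f := fun t : ℝ => min 1 (d * t) / t ^ ((d : ℝ) + 2 * s))]
  have hform : ∀ t : ℝ, 0 < t → t ^ (d - 1) • (min 1 (d * t) / t ^ ((d : ℝ) + 2 * s)) =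
      min 1 (d * t) * t ^ (-1 - 2 * s) := by
    intro t ht
    have : (-1 - 2 * s) = ((d - 1 : ℕ) : ℝ) - (d + 2 * s) := by
      push_cast [Nat.cast_sub hd]; ring
    rw [this, Real.rpow_sub ht, Real.rpow_natCast, smul_eq_mul]
    ring
  have hm : Measurable fun t : ℝ => min 1 (d * t) * t ^ (-1 - 2 * s) := by fun_prop
  refine IntegrableOn.congr_fun (f := fun t : ℝ => min 1 (d * t) * t ^ (-1 - 2 * s)) ?_
    (fun t ht => (hform t ht).symm) measurableSet_Ioi
  rw [← Ioc_union_Ioi_eq_Ioi (zero_le_one' ℝ)]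
  refine IntegrableOn.union ?_ ?_
  · have h : IntegrableOn (fun t : ℝ => d * t ^ (-2 * s)) (Ioc 0 1) := by
      rw [integrableOn_Ioc_iff_integrableOn_Ioo]
      exact ((intervalIntegral.integrableOn_Ioo_rpow_iff one_pos).2 (by linarith)).const_mul _
    refine h.mono' hm.aestronglyMeasurable ?_
    filter_upwards [ae_restrict_mem measurableSet_Ioc] with t ht
    have ht0 : 0 < t := ht.1
    rw [Real.norm_of_nonneg (by positivity)]
    calc min 1 (d * t) * t ^ (-1 - 2 * s) ≤ (d * t) * t ^ (-1 - 2 * s) := by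
          gcongr; exact min_le_right _ _
      _ = d * t ^ (-2 * s) := by
          rw [mul_assoc, ← Real.rpow_one_add' ht0.le (by linarith)]; ring_nf
  · have h : IntegrableOn (fun t : ℝ => t ^ (-1 - 2 * s)) (Ioi 1) :=
      integrableOn_Ioi_rpow_of_lt (by linarith) one_pos
    refine h.mono' hm.aestronglyMeasurable ?_
    filter_upwards [ae_restrict_mem measurableSet_Ioi] with t ht
    have ht0 : 0 < t := one_pos.trans ht
    rw [Real.norm_of_nonneg (by positivity)]
    exact mul_le_of_le_one_left (by positivity) (min_le_left _ _)

/-- The `2s`-fractional perimeter of a ball of radius `r` is finite, and it scales like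
`r ^ (d - 2 * s)`. -/
lemma exists_lintegral_ball_prod_compl_le {E : Type*} [NormedAddCommGroup E] [NormedSpace ℝ E]
    [FiniteDimensional ℝ E] [Nontrivial E] [MeasurableSpace E] [BorelSpace E]
    (μ : Measure E) [μ.IsAddHaarMeasure] {s : ℝ} (hs : 0 < s) (hs' : s < 1 / 2) :
    ∃ C : ℝ, 0 ≤ C ∧ ∀ (p : E) (r : ℝ), 0 < r →
      ∫⁻ z in ball p r ×ˢ (ball p r)ᶜ,
        ENNReal.ofReal (1 / ‖z.1 - z.2‖ ^ ((Module.finrank ℝ E : ℝ) + 2 * s)) ∂(μ.prod μ) ≤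
      ENNReal.ofReal (C * r ^ ((Module.finrank ℝ E : ℝ) - 2 * s)) := by
  have hint := integrable_min_div_norm_rpow μ hs hs'
  set d := Module.finrank ℝ E
  set a : ℝ := (d : ℝ) + 2 * s with ha
  set g : E → ℝ := fun z => min 1 (d * ‖z‖) / ‖z‖ ^ a with hg
  have hg0 : ∀ z, 0 ≤ g z := fun z => by positivity
  refine ⟨(∫ z, g z ∂μ) * μ.real (ball 0 1),
    mul_nonneg (integral_nonneg hg0) measureReal_nonneg, fun p r hr => ?_⟩
  set B := ball p r
  have hB : MeasurableSet B := measurableSet_ball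
  set k : E → ℝ≥0∞ := fun z => ENNReal.ofReal (1 / ‖z‖ ^ a) with hk
  have hkm : Measurable k := by fun_prop
  set f : E → E → ℝ≥0∞ := fun x z =>
    {w : E × E | w.1 ∈ B ∧ w.1 + w.2 ∉ B}.indicator (fun w => k w.2) (x, z) with hf
  have hset : MeasurableSet {w : E × E | w.1 ∈ B ∧ w.1 + w.2 ∉ B} :=
    (measurable_fst hB).inter ((measurable_fst.add measurable_snd) hB.compl)
  have hfm : Measurable (Function.uncurry f) :=
    (hkm.comp measurable_snd).indicator hset
  have hpt : ∀ z, k z * μ {x | x ∈ B ∧ x + z ∉ B} ≤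
      ENNReal.ofReal (r ^ (-(2 * s)) * g (r⁻¹ • z)) * μ (ball 0 1) := by
    intro z
    have hle : μ {x | x ∈ B ∧ x + z ∉ B} ≤ ENNReal.ofReal (r ^ d * min 1 (d * (‖z‖ / r))) *
      μ (ball 0 1) := measure_ball_translate_compl_le μ p z hr
    refine (mul_le_mul_right hle (k z)).trans_eq ?_
    rw [← mul_assoc, hk, ← ENNReal.ofReal_mul (by positivity)]
    congr 2
    rw [hg]
    simp only [norm_smul, norm_inv, Real.norm_of_nonneg hr.le]
    have h1 : r⁻¹ * ‖z‖ = ‖z‖ / r := by ring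
    rw [h1, Real.div_rpow (norm_nonneg z) hr.le, ha, Real.rpow_neg hr.le,
      Real.rpow_add hr, Real.rpow_natCast]
    field_simp
  calc ∫⁻ z in B ×ˢ Bᶜ, ENNReal.ofReal (1 / ‖z.1 - z.2‖ ^ a) ∂(μ.prod μ)
      = ∫⁻ w, (B ×ˢ Bᶜ).indicator (fun z => k (z.2 - z.1)) w ∂(μ.prod μ) := by
        rw [lintegral_indicator (hB.prod hB.compl)]
        simp only [hk, norm_sub_rev]
    _ ≤ ∫⁻ x, ∫⁻ y, (B ×ˢ Bᶜ).indicator (fun z => k (z.2 - z.1)) (x, y) ∂μ ∂μ :=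
        lintegral_prod_le _
    _ = ∫⁻ x, ∫⁻ z, f x z ∂μ ∂μ := by
        refine lintegral_congr fun x => ?_
        rw [← lintegral_add_left_eq_self _ x]
        refine lintegral_congr fun z => ?_
        classical
        simp only [hf, indicator_apply, mem_prod, mem_compl_iff, mem_ofPred_eq,
          add_sub_cancel_left]
    _ = ∫⁻ z, ∫⁻ x, f x z ∂μ ∂μ := lintegral_lintegral_swap hfm.aemeasurable
    _ = ∫⁻ z, k z * μ {x | x ∈ B ∧ x + z ∉ B} ∂μ := by
        refine lintegral_congr fun z => ?_
        have hz : MeasurableSet {x | x ∈ B ∧ x + z ∉ B} :=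
          hB.inter ((measurable_add_const z) hB.compl)
        rw [← lintegral_indicator_const hz]
        classical
        exact lintegral_congr fun x => by simp only [hf, indicator_apply, mem_ofPred_eq]
    _ ≤ ∫⁻ z, ENNReal.ofReal (r ^ (-(2 * s)) * g (r⁻¹ • z)) * μ (ball 0 1) ∂μ :=
        lintegral_mono hpt
    _ = ENNReal.ofReal (r ^ (-(2 * s)) * (r ^ d * ∫ z, g z ∂μ)) * μ (ball 0 1) := by
        rw [lintegral_mul_const' _ _ measure_ball_lt_top.ne,
          ← ofReal_integral_eq_lintegral_ofReal
            ((hint.comp_smul (inv_ne_zero hr.ne')).const_mul _)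
            (.of_forall fun z => mul_nonneg (by positivity) (hg0 _)),
          integral_const_mul, Measure.integral_comp_smul_of_nonneg μ g r⁻¹ (hR := by positivity)]
        simp [d]
    _ = _ := by
        rw [← ENNReal.ofReal_toReal (measure_ball_lt_top (μ := μ) (x := (0 : E)) (r := 1)).ne,
          ← ENNReal.ofReal_mul
            (mul_nonneg (by positivity) (mul_nonneg (by positivity) (integral_nonneg hg0))),
          ← measureReal_def,
          sub_eq_add_neg (d : ℝ), Real.rpow_add hr, Real.rpow_natCast]
        congr 1; ring

/-- Integrating a kernel that is symmetric under exchange of the variables over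
`(B × Bᶜ) ∪ (Bᶜ × B)` costs at most twice the integral over `B × Bᶜ`. -/
lemma setLIntegral_prod_compl_union_le {α : Type*} [MeasurableSpace α] (μ : Measure α)
    [SFinite μ] {B : Set α} (hB : MeasurableSet B) (K : α × α → ℝ≥0∞)
    (hK : ∀ z, K z.swap = K z) :
    ∫⁻ z in B ×ˢ Bᶜ ∪ Bᶜ ×ˢ B, K z ∂(μ.prod μ) ≤ 2 * ∫⁻ z in B ×ˢ Bᶜ, K z ∂(μ.prod μ) := by
  refine (lintegral_union_le _ _ _).trans_eq ?_
  rw [two_mul]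
  congr 1
  rw [← lintegral_indicator (hB.compl.prod hB), ← lintegral_indicator (hB.prod hB.compl),
    ← lintegral_prod_swap]
  refine lintegral_congr fun z => ?_
  classical
  simp only [indicator_apply, mem_prod, Prod.fst_swap, Prod.snd_swap, hK, and_comm]

/-- Raising the value `-1` to `-1 + θ` at one of two points lowers the kernel-weighted squared
difference, up to `θ ^ 2` times the kernel, if the value at the other point is at least
`-1 + b`. -/
lemma sq_abs_div_add_le {θ b w N m : ℝ} (hθ : 0 ≤ θ) (hb : 0 ≤ b) (hN : 0 ≤ N)
    (hm : m ≤ 1 / N) (hw : -1 + b ≤ w) :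
    |-1 + θ - w| ^ 2 / N + 2 * θ * b * m ≤ |-1 - w| ^ 2 / N + θ ^ 2 * (1 / N) := by
  rw [sq_abs, sq_abs, div_eq_mul_one_div, div_eq_mul_one_div ((-1 - w) ^ 2)]
  have hN' : 0 ≤ 1 / N := by positivity
  have h1 : 2 * θ * b * m ≤ 2 * θ * b * (1 / N) := by gcongr
  have h2 : 2 * θ * b * (1 / N) ≤ 2 * θ * (w + 1) * (1 / N) := by gcongr; linarith
  linarith [show (-1 + θ - w) ^ 2 * (1 / N) + 2 * θ * (w + 1) * (1 / N) =
    (-1 - w) ^ 2 * (1 / N) + θ ^ 2 * (1 / N) by ring]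

/-- Pointwise energy comparison: replacing the value `-1` on `B` by `-1 + θ` gains at least
`2 * θ * b * m` on `B × (B' \ B)` and costs at most `θ ^ 2 * k` on the interaction set of `B`. -/
lemma ofReal_energy_add_indicator_le {α : Type*} {B B' : Set α} [DecidablePred (· ∈ B)]
    {u : α → ℝ} (hu : ∀ x, -1 ≤ u x) {θ b m : ℝ} (hθ : 0 ≤ θ) (hb : 0 ≤ b) (hm : 0 ≤ m)
    {N : α × α → ℝ} (hN : ∀ z, 0 ≤ N z) (hmN : ∀ z ∈ B ×ˢ (B' \ B), m ≤ 1 / N z)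
    (z : α × α) (h1 : z.1 ∈ B → u z.1 = -1) (h2 : z.2 ∈ B → u z.2 = -1)
    (h3 : z.2 ∈ B' → -1 + b ≤ u z.2) :
    ENNReal.ofReal (|(if z.1 ∈ B then -1 + θ else u z.1) -
        (if z.2 ∈ B then -1 + θ else u z.2)| ^ 2 / N z) +
      (B ×ˢ (B' \ B)).indicator (fun _ => ENNReal.ofReal (2 * θ * b * m)) z ≤
    ENNReal.ofReal (|u z.1 - u z.2| ^ 2 / N z) +
      (B ×ˢ Bᶜ ∪ Bᶜ ×ˢ B).indicator
        (fun z => ENNReal.ofReal (θ ^ 2) * ENNReal.ofReal (1 / N z)) z := by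
  have hNz := hN z
  have hadd : ∀ x y : ℝ, 0 ≤ y → ENNReal.ofReal (x ^ 2 / N z) + ENNReal.ofReal y =
      ENNReal.ofReal (x ^ 2 / N z + y) := fun x y hy =>
    (ENNReal.ofReal_add (by positivity) hy).symm
  by_cases hz1 : z.1 ∈ B <;> by_cases hz2 : z.2 ∈ B
  · simp [indicator, hz1, hz2]
  · have hS : z ∈ B ×ˢ Bᶜ ∪ Bᶜ ×ˢ B := Or.inl ⟨hz1, hz2⟩
    rw [if_pos hz1, if_neg hz2, h1 hz1, indicator_of_mem hS,
      ← ENNReal.ofReal_mul (by positivity), hadd _ _ (by positivity)]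
    by_cases hz : z.2 ∈ B'
    · have hT : z ∈ B ×ˢ (B' \ B) := ⟨hz1, hz, hz2⟩
      rw [indicator_of_mem hT, hadd _ _ (by positivity)]
      exact ENNReal.ofReal_le_ofReal (sq_abs_div_add_le hθ hb hNz (hmN z hT) (h3 hz))
    · rw [indicator_of_notMem fun h => hz h.2.1, add_zero]
      refine ENNReal.ofReal_le_ofReal ?_
      simpa using sq_abs_div_add_le (b := 0) (m := 0) hθ le_rfl hNz (by positivity)
        (by simpa using hu z.2)
  · have hS : z ∈ B ×ˢ Bᶜ ∪ Bᶜ ×ˢ B := Or.inr ⟨hz1, hz2⟩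
    rw [if_neg hz1, if_pos hz2, h2 hz2, indicator_of_mem hS,
      ← ENNReal.ofReal_mul (by positivity), hadd _ _ (by positivity),
      indicator_of_notMem fun h => hz1 h.1, add_zero, abs_sub_comm, abs_sub_comm (u z.1)]
    refine ENNReal.ofReal_le_ofReal ?_
    simpa using sq_abs_div_add_le (b := 0) (m := 0) hθ le_rfl hNz (by positivity)
      (by simpa using hu z.1)
  · simp [indicator, hz1, hz2]

/-- Integrated form of the energy comparison, before choosing `θ`. -/
lemma JQ_ite_add_le {n : ℕ} {s : ℝ} {Ω : Set (EuclideanSpace ℝ (Fin n))}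
    {u : EuclideanSpace ℝ (Fin n) → ℝ} (hu : ∀ x, -1 ≤ u x)
    {B B' : Set (EuclideanSpace ℝ (Fin n))} [DecidablePred (· ∈ B)] (hB : MeasurableSet B)
    (hB' : MeasurableSet B') (hBΩ : B ⊆ Ω)
    (huB : ∀ᵐ x ∂(volume.restrict B), u x = -1) {θ b m : ℝ} (hθ : 0 ≤ θ) (hb : 0 < b)
    (hm : 0 ≤ m) (huB' : ∀ᵐ x ∂(volume.restrict B'), -1 + b ≤ u x)
    (hmN : ∀ z ∈ B ×ˢ (B' \ B), m ≤ 1 / ‖z.1 - z.2‖ ^ ((n : ℝ) + 2 * s)) :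
    JQ n s Ω (fun x => if x ∈ B then -1 + θ else u x) +
        ENNReal.ofReal (2 * θ * b * m) * (volume B * volume B') ≤
      JQ n s Ω u + ENNReal.ofReal (θ ^ 2) * (2 * ∫⁻ z in B ×ˢ Bᶜ,
        ENNReal.ofReal (1 / ‖z.1 - z.2‖ ^ ((n : ℝ) + 2 * s)) ∂(volume.prod volume)) := by
  set K : EuclideanSpace ℝ (Fin n) × EuclideanSpace ℝ (Fin n) → ℝ≥0∞ := fun z =>
    ENNReal.ofReal (1 / ‖z.1 - z.2‖ ^ ((n : ℝ) + 2 * s)) with hK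
  have hKm : Measurable K := by fun_prop
  rw [ae_restrict_iff' hB] at huB
  rw [ae_restrict_iff' hB'] at huB'
  have hnull : volume (B' ∩ B) = 0 := by
    rw [measure_eq_zero_iff_ae_notMem]
    filter_upwards [huB, huB'] with x h1 h2 hx
    linarith [h1 hx.2, h2 hx.1]
  set T := B ×ˢ (B' \ B)
  set S := B ×ˢ Bᶜ ∪ Bᶜ ×ˢ B
  have hT : MeasurableSet T := hB.prod (hB'.diff hB)
  have hS : MeasurableSet S := (hB.prod hB.compl).union (hB.compl.prod hB)
  have hTQ : T ⊆ (Ωᶜ ×ˢ Ωᶜ)ᶜ := fun z hz h => h.1 (hBΩ hz.1)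
  have hvolT : (volume.restrict (Ωᶜ ×ˢ Ωᶜ)ᶜ) T = volume B * volume B' := by
    rw [Measure.restrict_apply hT, inter_eq_left.2 hTQ, Measure.volume_eq_prod,
      Measure.prod_prod, measure_sdiff_null' hnull]
  have hae : ∀ᵐ z : EuclideanSpace ℝ (Fin n) × EuclideanSpace ℝ (Fin n),
      (z.1 ∈ B → u z.1 = -1) ∧ (z.2 ∈ B → u z.2 = -1) ∧ (z.2 ∈ B' → -1 + b ≤ u z.2) := by
    rw [Measure.volume_eq_prod]
    filter_upwards [Measure.quasiMeasurePreserving_fst.ae huB,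
      Measure.quasiMeasurePreserving_snd.ae huB, Measure.quasiMeasurePreserving_snd.ae huB']
      with z h1 h2 h3 using ⟨h1, h2, h3⟩
  have hcost : ∫⁻ z in (Ωᶜ ×ˢ Ωᶜ)ᶜ, S.indicator (fun z => ENNReal.ofReal (θ ^ 2) * K z) z ≤
      ENNReal.ofReal (θ ^ 2) * (2 * ∫⁻ z in B ×ˢ Bᶜ, K z ∂(volume.prod volume)) := by
    refine (setLIntegral_le_lintegral _ _).trans ?_
    rw [lintegral_indicator hS, lintegral_const_mul _ hKm, Measure.volume_eq_prod]
    gcongr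
    exact setLIntegral_prod_compl_union_le volume hB K fun z => by simp [hK, norm_sub_rev]
  calc JQ n s Ω (fun x => if x ∈ B then -1 + θ else u x) +
        ENNReal.ofReal (2 * θ * b * m) * (volume B * volume B')
      = ∫⁻ z in (Ωᶜ ×ˢ Ωᶜ)ᶜ, (ENNReal.ofReal (|(if z.1 ∈ B then -1 + θ else u z.1) -
          (if z.2 ∈ B then -1 + θ else u z.2)| ^ 2 / ‖z.1 - z.2‖ ^ ((n : ℝ) + 2 * s)) +
          T.indicator (fun _ => ENNReal.ofReal (2 * θ * b * m)) z) := by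
        rw [lintegral_add_right _ (measurable_const.indicator hT),
          lintegral_indicator_const hT, hvolT, JQ]
    _ ≤ ∫⁻ z in (Ωᶜ ×ˢ Ωᶜ)ᶜ, (ENNReal.ofReal (|u z.1 - u z.2| ^ 2 /
          ‖z.1 - z.2‖ ^ ((n : ℝ) + 2 * s)) +
          S.indicator (fun z => ENNReal.ofReal (θ ^ 2) * K z) z) := by
        refine lintegral_mono_ae (ae_restrict_of_ae ?_)
        filter_upwards [hae] with z hz
        exact ofReal_energy_add_indicator_le hu hθ hb.le hm
          (N := fun z => ‖z.1 - z.2‖ ^ ((n : ℝ) + 2 * s)) (fun z => by positivity) hmN z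
          hz.1 hz.2.1 hz.2.2
    _ ≤ _ := by
        rw [lintegral_add_right _ ((hKm.const_mul _).indicator hS), ← JQ]
        gcongr

/-- Proposition 3.1: for `n ≥ 1`, `b > 0`, `c ∈ (0,1/2)`, there exist
`ς > 0` and `θ ∈ (0,b)`, depending only on `n`, `s`, `b`, `c`, such that: whenever `Ω ⊆ ℝⁿ`
is open, `ū : ℝⁿ → [-1,1]` is measurable with `ū(Q_Ω) < ∞`, and there are `δ > 0` and points
`p`, `q` with `|p-q| < δ`, `B_{cδ}(p) ⊆ Ω`, `ū = -1` a.e. in `B_{cδ}(p)` and `ū ≥ -1+b` a.e.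
in `B_{cδ}(q)`, then the function obtained from `ū` by setting the value `-1+θ` on `B_{cδ}(p)`
has kinetic energy at most `ū(Q_Ω) - ς δ^{n-2s}`. -/
theorem statement7
    (n : ℕ) (hn : 1 ≤ n) (s : ℝ) (hs : 0 < s) (hs' : s < 1 / 2)
    (b : ℝ) (hb : 0 < b) (c : ℝ) (hc : c ∈ Ioo (0 : ℝ) (1 / 2)) :
    ∃ ς > (0 : ℝ), ∃ θ ∈ Ioo (0 : ℝ) b,
      ∀ Ω : Set (EuclideanSpace ℝ (Fin n)), IsOpen Ω →
      ∀ ubar : EuclideanSpace ℝ (Fin n) → ℝ, Measurable ubar →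
        (∀ x, ubar x ∈ Icc (-1 : ℝ) 1) → JQ n s Ω ubar ≠ ⊤ →
      ∀ δ > (0 : ℝ), ∀ p q : EuclideanSpace ℝ (Fin n),
        dist p q < δ → ball p (c * δ) ⊆ Ω →
        (∀ᵐ x ∂(volume.restrict (ball p (c * δ))), ubar x = -1) →
        (∀ᵐ x ∂(volume.restrict (ball q (c * δ))), -1 + b ≤ ubar x) →
        JQ n s Ω (fun x => if dist x p < c * δ then -1 + θ else ubar x) ≠ ⊤ ∧
        (JQ n s Ω (fun x => if dist x p < c * δ then -1 + θ else ubar x)).toReal ≤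
          (JQ n s Ω ubar).toReal - ς * δ ^ ((n : ℝ) - 2 * s) := by
  have : Nonempty (Fin n) := ⟨⟨0, hn⟩⟩
  obtain ⟨C, hC, hper⟩ := exists_lintegral_ball_prod_compl_le
    (volume : Measure (EuclideanSpace ℝ (Fin n))) hs hs'
  rw [finrank_euclideanSpace_fin] at hper
  have hc0 : 0 < c := hc.1
  set ω := volume.real (ball (0 : EuclideanSpace ℝ (Fin n)) 1) with hω
  have hω0 : 0 < ω := ENNReal.toReal_pos (measure_ball_pos _ _ one_pos).ne' measure_ball_lt_top.ne
  set κ := c ^ n * ω * (c ^ n * ω) / 2 ^ ((n : ℝ) + 2 * s) with hκ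
  have hκ0 : 0 < κ := by positivity
  set D := 2 * C * c ^ ((n : ℝ) - 2 * s) with hD
  have hD0 : 0 ≤ D := by positivity
  set θ := min (b / 2) (b * κ / (D + 1)) with hθ
  have hθ0 : 0 < θ := by positivity
  have hθD : θ ^ 2 * D ≤ θ * b * κ := by
    have h1 : θ * (D + 1) ≤ b * κ := (le_div_iff₀ (by positivity)).1 (min_le_right _ _)
    nlinarith
  refine ⟨θ * b * κ, by positivity, θ, ⟨hθ0, (min_le_left _ _).trans_lt (by linarith)⟩, ?_⟩
  intro Ω _ u _ hu hfin δ hδ p q hpq hpΩ hup huq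
  have hr : 0 < c * δ := by positivity
  set X := θ * b * κ * δ ^ ((n : ℝ) - 2 * s) with hX
  have hX0 : 0 ≤ X := by positivity
  have hvol : ∀ x : EuclideanSpace ℝ (Fin n),
      volume (ball x (c * δ)) = ENNReal.ofReal ((c * δ) ^ n * ω) := by
    intro x
    rw [Measure.addHaar_ball _ _ hr.le, finrank_euclideanSpace_fin,
      ENNReal.ofReal_mul (by positivity), hω, measureReal_def,
      ENNReal.ofReal_toReal measure_ball_lt_top.ne]
  have hkernel : ∀ z ∈ ball p (c * δ) ×ˢ (ball q (c * δ) \ ball p (c * δ)),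
      1 / (2 * δ) ^ ((n : ℝ) + 2 * s) ≤ 1 / ‖z.1 - z.2‖ ^ ((n : ℝ) + 2 * s) := by
    rintro ⟨x, y⟩ ⟨hx, hy, hy'⟩
    have hxy : 0 < ‖x - y‖ := norm_sub_pos_iff.2 fun h => hy' (h ▸ hx)
    have hle : ‖x - y‖ ≤ 2 * δ := by
      rw [← dist_eq_norm]
      have h1 : dist x p < c * δ := hx
      have h2 : dist y q < c * δ := hy
      have h3 := dist_triangle4 x p q y
      rw [dist_comm q y] at h3
      nlinarith [hc.2]
    exact one_div_le_one_div_of_le (by positivity)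
      (Real.rpow_le_rpow hxy.le hle (by positivity))
  classical
  have hmain := JQ_ite_add_le (s := s) (Ω := Ω) (θ := θ) (fun x => (hu x).1)
    measurableSet_ball measurableSet_ball hpΩ hup hθ0.le hb (by positivity) huq hkernel
  have hgain : ENNReal.ofReal (2 * θ * b * (1 / (2 * δ) ^ ((n : ℝ) + 2 * s))) *
      (volume (ball p (c * δ)) * volume (ball q (c * δ))) = ENNReal.ofReal (2 * X) := by
    rw [hvol, hvol, ← ENNReal.ofReal_mul (by positivity), ← ENNReal.ofReal_mul (by positivity)]
    congr 1
    have hpow : δ ^ ((n : ℝ) - 2 * s) = δ ^ n * δ ^ n / δ ^ ((n : ℝ) + 2 * s) := by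
      rw [← Real.rpow_natCast, ← Real.rpow_add hδ, ← Real.rpow_sub hδ]
      ring_nf
    rw [hX, hκ, hpow, Real.mul_rpow zero_le_two hδ.le, mul_pow]
    field_simp
  have hcost : ENNReal.ofReal (θ ^ 2) * (2 * ∫⁻ z in ball p (c * δ) ×ˢ (ball p (c * δ))ᶜ,
      ENNReal.ofReal (1 / ‖z.1 - z.2‖ ^ ((n : ℝ) + 2 * s)) ∂(volume.prod volume)) ≤
      ENNReal.ofReal X := by
    calc _ ≤ ENNReal.ofReal (θ ^ 2) *
          (ENNReal.ofReal 2 * ENNReal.ofReal (C * (c * δ) ^ ((n : ℝ) - 2 * s))) := by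
          rw [ENNReal.ofReal_ofNat]
          gcongr
          exact hper p _ hr
      _ = ENNReal.ofReal (θ ^ 2 * D * δ ^ ((n : ℝ) - 2 * s)) := by
          rw [← ENNReal.ofReal_mul zero_le_two, ← ENNReal.ofReal_mul (by positivity),
            Real.mul_rpow hc0.le hδ.le, hD]
          congr 1
          ring
      _ ≤ ENNReal.ofReal X := by rw [hX]; gcongr
  rw [hgain] at hmain
  replace hmain := hmain.trans (add_le_add_right hcost _)
  have heq : (fun x => if dist x p < c * δ then -1 + θ else u x) =
      fun x => if x ∈ ball p (c * δ) then -1 + θ else u x := by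
    simp only [mem_ball]
  rw [heq]
  have htop : JQ n s Ω (fun x => if x ∈ ball p (c * δ) then -1 + θ else u x) ≠ ⊤ :=
    ne_top_of_le_ne_top (ENNReal.add_ne_top.2 ⟨hfin, ENNReal.ofReal_ne_top⟩)
      (le_self_add.trans hmain)
  refine ⟨htop, ?_⟩
  have h := ENNReal.toReal_mono (ENNReal.add_ne_top.2 ⟨hfin, ENNReal.ofReal_ne_top⟩) hmain
  rw [ENNReal.toReal_add htop ENNReal.ofReal_ne_top, ENNReal.toReal_add hfin
    ENNReal.ofReal_ne_top, ENNReal.toReal_ofReal (by positivity),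
    ENNReal.toReal_ofReal hX0] at h
  linarith
end
end

section
/- Let Ω ⊆ ℝⁿ be open, B ⊆ Ω an open ball, and ū : ℝⁿ → [−1,1] measurable with ū(Q_Ω) < ∞ and ū = −1 a.e. on B. Let θ ∈ (0,2) and define u := ū + θ χ_B (i.e. u = −1+θ on B and u = ū elsewhere). Then u(Q_Ω) − ū(Q_Ω) = 2θ ∬_{B×(ℝⁿ\B)} ( θ − 2 − 2ū(y) ) / |x−y|^{n+2s} dx dy. -/
open MeasureTheory Filter Set Metric
open scoped ENNReal NNReal Topology

noncomputable section

section BallInteraction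

variable {E : Type*} [NormedAddCommGroup E] [NormedSpace ℝ E] [FiniteDimensional ℝ E]
  [Nontrivial E] [MeasurableSpace E] [BorelSpace E] (μ : Measure E) [μ.IsAddHaarMeasure]

/-- The part of a ball that a translation by `h` moves out of it has measure at most
a constant times `min 1 ‖h‖`. -/
theorem exists_measure_ball_inter_translate_compl_le (p : E) {r : ℝ} (hr : 0 < r) :
    ∃ C : ℝ, 0 ≤ C ∧ ∀ h : E,
      μ (ball p r ∩ {x | h + x ∉ ball p r}) ≤ ENNReal.ofReal (C * min 1 ‖h‖) := by
  set d := Module.finrank ℝ E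
  have hd1 : 1 ≤ (d : ℝ) := by exact_mod_cast Module.finrank_pos (R := ℝ) (M := E)
  set v := μ.real (ball (0 : E) 1) with hv
  have hv0 : 0 ≤ v := measureReal_nonneg
  have hvol : ∀ ρ : ℝ, 0 ≤ ρ → μ.real (ball p ρ) = ρ ^ d * v := fun ρ hρ => by
    rw [measureReal_def, Measure.addHaar_ball μ p hρ, ENNReal.toReal_mul,
      ENNReal.toReal_ofReal (by positivity), hv, measureReal_def]
  refine ⟨v * r ^ d * (1 + d / r), by positivity, fun h => ?_⟩
  have hfinite : μ (ball p r ∩ {x | h + x ∉ ball p r}) ≠ ⊤ :=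
    measure_ne_top_of_subset inter_subset_left measure_ball_lt_top.ne
  rw [← ofReal_measureReal hfinite]
  refine ENNReal.ofReal_le_ofReal ?_
  have hle_one : μ.real (ball p r ∩ {x | h + x ∉ ball p r}) ≤ v * r ^ d := by
    rw [mul_comm, ← hvol r hr.le]
    exact measureReal_mono inter_subset_left measure_ball_lt_top.ne
  have hle_norm : μ.real (ball p r ∩ {x | h + x ∉ ball p r}) ≤ v * r ^ d * (d / r * ‖h‖) := by
    rcases le_or_gt r ‖h‖ with hrh | hrh
    · refine hle_one.trans (le_mul_of_one_le_right (by positivity) ?_)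
      rw [div_mul_eq_mul_div, one_le_div hr]
      nlinarith
    · have hsub : ball p r ∩ {x | h + x ∉ ball p r} ⊆ ball p r \ ball p (r - ‖h‖) := by
        rintro x ⟨hx, hhx⟩
        refine ⟨hx, fun hx' => hhx ?_⟩
        rw [mem_ball, dist_eq_norm] at hx' ⊢
        calc ‖h + x - p‖ = ‖h + (x - p)‖ := by rw [add_sub_assoc]
          _ ≤ ‖h‖ + ‖x - p‖ := norm_add_le _ _
          _ < r := by linarith
      have hdiff : μ.real (ball p r \ ball p (r - ‖h‖)) = r ^ d * v - (r - ‖h‖) ^ d * v := by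
        rw [measureReal_sdiff (ball_subset_ball (by linarith [norm_nonneg h])) measurableSet_ball
          measure_ball_lt_top.ne, hvol r hr.le, hvol _ (by linarith)]
      have hbern : 1 + (d : ℝ) * (-(‖h‖ / r)) ≤ (1 + -(‖h‖ / r)) ^ d :=
        one_add_mul_le_pow (by
          have : ‖h‖ / r < 1 := (div_lt_one hr).2 hrh
          linarith) d
      have hpow : (r - ‖h‖) ^ d = r ^ d * (1 + -(‖h‖ / r)) ^ d := by
        rw [← mul_pow]
        congr 1
        field_simp
        ring
      calc _ ≤ μ.real (ball p r \ ball p (r - ‖h‖)) :=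
            measureReal_mono hsub (measure_ne_top_of_subset sdiff_subset measure_ball_lt_top.ne)
        _ = v * r ^ d * (1 - (1 + -(‖h‖ / r)) ^ d) := by rw [hdiff, hpow]; ring
        _ ≤ v * r ^ d * (d / r * ‖h‖) := by
            refine mul_le_mul_of_nonneg_left ?_ (by positivity)
            have : (d : ℝ) / r * ‖h‖ = d * (‖h‖ / r) := by ring
            linarith
  have hc : 0 ≤ (d : ℝ) / r := by positivity
  have hw : 0 ≤ v * r ^ d := by positivity
  rw [mul_assoc]
  rcases min_cases 1 ‖h‖ with ⟨hm, -⟩ | ⟨hm, -⟩ <;> rw [hm]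
  · exact hle_one.trans (le_mul_of_one_le_right hw (by linarith))
  · refine hle_norm.trans (mul_le_mul_of_nonneg_left ?_ hw)
    nlinarith [norm_nonneg h]

theorem integrable_min_one_norm_div_rpow {s : ℝ} (hs : 0 < s) (hs' : s < 1 / 2) :
    Integrable (fun h : E => min 1 ‖h‖ * (1 / ‖h‖ ^ ((Module.finrank ℝ E : ℝ) + 2 * s))) μ := by
  set d := Module.finrank ℝ E
  have hd1 : 1 ≤ d := Module.finrank_pos (R := ℝ) (M := E)
  rw [integrable_fun_norm_addHaar μ (f := fun t : ℝ => min 1 t * (1 / t ^ ((d : ℝ) + 2 * s))),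
    ← Ioc_union_Ioi_eq_Ioi (zero_le_one' ℝ)]
  have hpow : ∀ t : ℝ, 0 < t →
      t ^ (d - 1) * (1 / t ^ ((d : ℝ) + 2 * s)) = t ^ (-1 - 2 * s) := fun t ht => by
    rw [one_div, ← Real.rpow_neg ht.le, ← Real.rpow_natCast, ← Real.rpow_add ht, Nat.cast_sub hd1]
    congr 1
    push_cast
    ring
  refine IntegrableOn.union ?_ ?_
  · have hint : IntegrableOn (fun t : ℝ => t ^ (-(2 * s))) (Ioc 0 1) :=
      (intervalIntegrable_iff_integrableOn_Ioc_of_le zero_le_one).1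
        (intervalIntegral.intervalIntegrable_rpow' (by linarith))
    refine hint.congr_fun (fun t ht => ?_) measurableSet_Ioc
    simp only [smul_eq_mul]
    rw [min_eq_right ht.2, mul_left_comm, hpow t ht.1]
    nth_rewrite 2 [← Real.rpow_one t]
    rw [← Real.rpow_add ht.1]
    congr 1
    ring
  · have hint : IntegrableOn (fun t : ℝ => t ^ (-1 - 2 * s)) (Ioi 1) :=
      integrableOn_Ioi_rpow_of_lt (by linarith) one_pos
    refine hint.congr_fun (fun t ht => ?_) measurableSet_Ioi
    simp only [smul_eq_mul]
    rw [min_eq_left (le_of_lt ht), one_mul, hpow t (one_pos.trans ht)]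

/-- The fractional perimeter of a ball is finite. -/
theorem integrableOn_ball_prod_compl_one_div_rpow (p : E) {r : ℝ} (hr : 0 < r)
    {s : ℝ} (hs : 0 < s) (hs' : s < 1 / 2) :
    IntegrableOn (fun z : E × E => 1 / ‖z.1 - z.2‖ ^ ((Module.finrank ℝ E : ℝ) + 2 * s))
      (ball p r ×ˢ (ball p r)ᶜ) (μ.prod μ) := by
  set q := (Module.finrank ℝ E : ℝ) + 2 * s
  set B := ball p r
  have hBm : MeasurableSet B := measurableSet_ball
  have hmeas : Measurable (fun z : E × E => 1 / ‖z.1 - z.2‖ ^ q) := by fun_prop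
  refine ⟨hmeas.aestronglyMeasurable, ?_⟩
  rw [hasFiniteIntegral_iff_ofReal (.of_forall fun z => by positivity)]
  obtain ⟨C, hC, hbound⟩ := exists_measure_ball_inter_translate_compl_le μ p hr
  set k : E → ℝ≥0∞ := fun h => ENNReal.ofReal (1 / ‖h‖ ^ q) with hk
  have hkm : Measurable k := by fun_prop
  have hset : MeasurableSet {w : E × E | w.1 ∈ B ∧ w.2 + w.1 ∉ B} :=
    (measurable_fst hBm).inter ((measurable_snd.add measurable_fst) hBm).compl
  calc ∫⁻ z in B ×ˢ Bᶜ, ENNReal.ofReal (1 / ‖z.1 - z.2‖ ^ q) ∂μ.prod μ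
      = ∫⁻ x, ∫⁻ y, (B ×ˢ Bᶜ).indicator (fun z => k (z.1 - z.2)) (x, y) ∂μ ∂μ := by
        rw [← lintegral_indicator (hBm.prod hBm.compl), lintegral_prod]
        exact ((hkm.comp (measurable_fst.sub measurable_snd)).indicator
          (hBm.prod hBm.compl)).aemeasurable
    _ = ∫⁻ x, ∫⁻ h, {w : E × E | w.1 ∈ B ∧ w.2 + w.1 ∉ B}.indicator (fun w => k w.2) (x, h)
          ∂μ ∂μ := by
        refine lintegral_congr fun x => ?_
        rw [← lintegral_add_right_eq_self _ x]
        refine lintegral_congr fun h => ?_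
        simp only [indicator, hk, sub_add_cancel_right, norm_neg]
        rfl
    _ = ∫⁻ h, ∫⁻ x, {w : E × E | w.1 ∈ B ∧ w.2 + w.1 ∉ B}.indicator (fun w => k w.2) (x, h)
          ∂μ ∂μ :=
        lintegral_lintegral_swap ((hkm.comp measurable_snd).indicator hset).aemeasurable
    _ = ∫⁻ h, k h * μ (B ∩ {x | h + x ∉ B}) ∂μ := by
        refine lintegral_congr fun h => ?_
        exact lintegral_indicator_const (hBm.inter (measurable_const_add h hBm).compl) (k h)
    _ ≤ ∫⁻ h, ENNReal.ofReal (C * (min 1 ‖h‖ * (1 / ‖h‖ ^ q))) ∂μ := by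
        refine lintegral_mono fun h => ?_
        calc k h * μ (B ∩ {x | h + x ∉ B})
            ≤ ENNReal.ofReal (1 / ‖h‖ ^ q) * ENNReal.ofReal (C * min 1 ‖h‖) := by
              gcongr
              exact hbound h
          _ = _ := by
              rw [← ENNReal.ofReal_mul (by positivity)]
              congr 1
              ring
    _ < ⊤ := by
        rw [← hasFiniteIntegral_iff_ofReal (.of_forall fun h => by positivity)]
        exact ((integrable_min_one_norm_div_rpow μ hs hs').const_mul C).hasFiniteIntegral

end BallInteraction

/-- if `B ⊆ Ω` is an open ball, `ū : ℝⁿ → [-1,1]` has finite kinetic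
energy and `ū = -1` a.e. on `B`, and `u = ū + θ χ_B` with `θ ∈ (0,2)`, then
`u(Q_Ω) - ū(Q_Ω) = 2θ ∬_{B×(ℝⁿ\B)} (θ - 2 - 2ū(y))/|x-y|^{n+2s} dx dy`. -/
theorem statement8
    (n : ℕ) (hn : 1 ≤ n) (s : ℝ) (hs : 0 < s) (hs' : s < 1 / 2)
    (Ω : Set (EuclideanSpace ℝ (Fin n))) (hΩo : IsOpen Ω)
    (B : Set (EuclideanSpace ℝ (Fin n))) (hB : ∃ p r, 0 < r ∧ B = ball p r)
    (hBΩ : B ⊆ Ω)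
    (ubar : EuclideanSpace ℝ (Fin n) → ℝ) (hmeas : Measurable ubar)
    (hval : ∀ x, ubar x ∈ Icc (-1 : ℝ) 1)
    (hfin : JQ n s Ω ubar ≠ ⊤)
    (hB1 : ∀ᵐ x ∂(volume.restrict B), ubar x = -1)
    (θ : ℝ) (hθ : θ ∈ Ioo (0 : ℝ) 2) :
    JQ n s Ω (fun x => ubar x + θ * B.indicator (fun _ => (1 : ℝ)) x) ≠ ⊤ ∧
    (JQ n s Ω (fun x => ubar x + θ * B.indicator (fun _ => (1 : ℝ)) x)).toReal -
        (JQ n s Ω ubar).toReal =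
      2 * θ * ∫ z : EuclideanSpace ℝ (Fin n) × EuclideanSpace ℝ (Fin n) in B ×ˢ Bᶜ,
        (θ - 2 - 2 * ubar z.2) / ‖z.1 - z.2‖ ^ ((n : ℝ) + 2 * s) := by
  obtain ⟨p, r, hr, rfl⟩ := hB
  have : Nonempty (Fin n) := ⟨⟨0, hn⟩⟩
  set B := ball p r
  set q := (n : ℝ) + 2 * s
  set Q := (Ωᶜ ×ˢ Ωᶜ)ᶜ with hQ
  set u := fun x => ubar x + θ * B.indicator (fun _ => (1 : ℝ)) x with hu
  let F := fun (w : EuclideanSpace ℝ (Fin n) → ℝ)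
    (z : EuclideanSpace ℝ (Fin n) × EuclideanSpace ℝ (Fin n)) =>
      |w z.1 - w z.2| ^ 2 / ‖z.1 - z.2‖ ^ q
  have hF0 : ∀ w z, 0 ≤ F w z := fun w z => by positivity
  have hBm : MeasurableSet B := measurableSet_ball
  let g := fun z : EuclideanSpace ℝ (Fin n) × EuclideanSpace ℝ (Fin n) =>
    (θ - 2 - 2 * ubar z.2) / ‖z.1 - z.2‖ ^ q
  let H := (B ×ˢ Bᶜ).indicator g
  have hHint : Integrable H := by
    have hker := integrableOn_ball_prod_compl_one_div_rpow
      (volume : Measure (EuclideanSpace ℝ (Fin n))) p hr hs hs'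
    rw [finrank_euclideanSpace_fin, ← Measure.volume_eq_prod] at hker
    refine (integrable_indicator_iff (hBm.prod hBm.compl)).2 ?_
    have hgeq : g = fun z => (θ - 2 - 2 * ubar z.2) * (1 / ‖z.1 - z.2‖ ^ q) := by
      funext z
      exact div_eq_mul_one_div _ _
    rw [hgeq]
    refine hker.bdd_mul (c := 6) (Measurable.aestronglyMeasurable (by fun_prop))
      (.of_forall fun z => ?_)
    have h1 := (hval z.2).1
    have h2 := (hval z.2).2
    rw [Real.norm_eq_abs, abs_le]
    constructor <;> linarith [hθ.1, hθ.2]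
  have hHswap : Integrable (fun z : EuclideanSpace ℝ (Fin n) × EuclideanSpace ℝ (Fin n) => H z.swap) := by
    rw [Measure.volume_eq_prod] at hHint ⊢
    exact hHint.swap
  have hQ_of_fst : ∀ z : EuclideanSpace ℝ (Fin n) × EuclideanSpace ℝ (Fin n), z ∉ Q →
      z.1 ∉ B ∧ z.2 ∉ B := fun z hz => by
    rw [hQ, notMem_compl_iff] at hz
    exact ⟨fun h => hz.1 (hBΩ h), fun h => hz.2 (hBΩ h)⟩
  have hHQ : ∫ z in Q, H z = ∫ z in B ×ˢ Bᶜ, g z := by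
    rw [setIntegral_eq_integral_of_forall_compl_eq_zero,
      integral_indicator (hBm.prod hBm.compl)]
    exact fun z hz => indicator_of_notMem (fun h => (hQ_of_fst z hz).1 h.1) _
  have hHswapQ : ∫ z in Q, H z.swap = ∫ z in B ×ˢ Bᶜ, g z := by
    rw [setIntegral_eq_integral_of_forall_compl_eq_zero, Measure.volume_eq_prod,
      integral_prod_swap, integral_indicator (hBm.prod hBm.compl)]
    exact fun z hz => indicator_of_notMem (fun h => (hQ_of_fst z hz).2 h.1) _
  have hFm : Measurable (F ubar) := by fun_prop
  have hFint : IntegrableOn (F ubar) Q :=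
    ⟨hFm.aestronglyMeasurable,
      (hasFiniteIntegral_iff_ofReal (.of_forall (hF0 ubar))).2 (lt_top_iff_ne_top.2 hfin)⟩
  have hae : F u =ᵐ[volume.restrict Q] fun z => F ubar z + θ * (H z + H z.swap) := by
    have hB1' := (ae_restrict_iff' hBm).1 hB1
    have hfst : ∀ᵐ z : EuclideanSpace ℝ (Fin n) × EuclideanSpace ℝ (Fin n),
        z.1 ∈ B → ubar z.1 = -1 := Measure.quasiMeasurePreserving_fst.ae hB1'
    have hsnd : ∀ᵐ z : EuclideanSpace ℝ (Fin n) × EuclideanSpace ℝ (Fin n),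
        z.2 ∈ B → ubar z.2 = -1 := Measure.quasiMeasurePreserving_snd.ae hB1'
    refine ae_restrict_of_ae ?_
    filter_upwards [hfst, hsnd] with z h1 h2
    simp only [F, H, g, hu, sq_abs]
    by_cases hz1 : z.1 ∈ B <;> by_cases hz2 : z.2 ∈ B
    · simp [hz1, hz2]
    · simp only [indicator, mem_prod, mem_compl_iff, hz1, hz2, h1 hz1, Prod.fst_swap,
        Prod.snd_swap, not_true, not_false_iff, and_true, and_false, if_true, if_false]
      ring
    · simp only [indicator, mem_prod, mem_compl_iff, hz1, hz2, h2 hz2, Prod.fst_swap,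
        Prod.snd_swap, not_true, not_false_iff, and_true, and_false, if_true, if_false,
        norm_sub_rev z.2 z.1]
      ring
    · simp [hz1, hz2]
  have hGint : IntegrableOn (fun z => θ * (H z + H z.swap)) Q :=
    ((hHint.add hHswap).const_mul θ).integrableOn
  have hFuint : IntegrableOn (F u) Q := (hFint.add hGint).congr hae.symm
  have htoReal : ∀ w, IntegrableOn (F w) Q → (JQ n s Ω w).toReal = ∫ z in Q, F w z :=
    fun w hw => (integral_eq_lintegral_of_nonneg_ae (.of_forall (hF0 w)) hw.1).symm
  refine ⟨((hasFiniteIntegral_iff_ofReal (.of_forall (hF0 u))).1 hFuint.2).ne, ?_⟩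
  rw [htoReal u hFuint, htoReal ubar hFint, integral_congr_ae hae,
    integral_add hFint hGint, integral_const_mul,
    integral_add hHint.integrableOn hHswap.integrableOn, hHQ, hHswapQ]
  ring
end
end

section
/- Let n ≥ 1, s ∈ (0,1/2), b > 0, c ∈ (0,1/2), let Ω ⊆ ℝⁿ be open, and let ς > 0 and θ ∈ (0,b) be the constants (depending only on n, s, b and c) from the single-ball energy-drop estimate. Let δ > 0, N ∈ ℕ, and let x₁,…,x_N ∈ Ω be points with |x_i − x_j| > 2·(δ/2) for i ≠ j and B_{δ/2}(x_i) ⊆ Ω for every i (so the balls B_{δ/2}(x_i) are pairwise disjoint). Suppose ū : ℝⁿ → [−1,1] is measurable with ū(Q_Ω) < ∞ and that for every i there exist p_i, q_i with B_{cδ}(p_i) ⊆ B_{δ/2}(x_i), B_{cδ}(q_i) ⊆ B_{δ/2}(x_i), ū = −1 a.e. on B_{cδ}(p_i), and ū ≥ −1+b a.e. on B_{cδ}(q_i). Then the function u_δ := ū + θ Σ_{i=1}^N χ_{B_{cδ}(p_i)} (i.e. u_δ = −1+θ on each B_{cδ}(p_i) and u_δ = ū elsewhere) satisfies u_δ(Q_Ω)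 ≤ ū(Q_Ω) − N ς δ^{n−2s}. -/
open MeasureTheory Filter Set Metric
open scoped ENNReal NNReal Topology

noncomputable section

/-- The single-ball energy-drop estimate (Proposition 3.1) for the constants `ς`, `θ`:
modifying `ū` to the value `-1+θ` on `B_{cδ}(p)` decreases the kinetic energy by at least
`ς δ^{n-2s}`, whenever `|p-q| < δ`, `B_{cδ}(p) ⊆ Ω`, `ū = -1` a.e. on `B_{cδ}(p)` and
`ū ≥ -1+b` a.e. on `B_{cδ}(q)`. -/
def SingleBallDrop (n : ℕ) (s b c ς θ : ℝ) (Ω : Set (EuclideanSpace ℝ (Fin n))) : Prop :=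
  ∀ ubar : EuclideanSpace ℝ (Fin n) → ℝ, Measurable ubar →
    (∀ x, ubar x ∈ Icc (-1 : ℝ) 1) → JQ n s Ω ubar ≠ ⊤ →
  ∀ δ > (0 : ℝ), ∀ p q : EuclideanSpace ℝ (Fin n),
    dist p q < δ → ball p (c * δ) ⊆ Ω →
    (∀ᵐ x ∂(volume.restrict (ball p (c * δ))), ubar x = -1) →
    (∀ᵐ x ∂(volume.restrict (ball q (c * δ))), -1 + b ≤ ubar x) →
    JQ n s Ω (fun x => if dist x p < c * δ then -1 + θ else ubar x) ≠ ⊤ ∧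
    (JQ n s Ω (fun x => if dist x p < c * δ then -1 + θ else ubar x)).toReal ≤
      (JQ n s Ω ubar).toReal - ς * δ ^ ((n : ℝ) - 2 * s)

/-- A ball on which a function with values in `[-1, 1]` is almost everywhere at least `-1 + b`
forces `b ≤ 2`. -/
theorem le_two_of_ae_ge_on_ball {n : ℕ} {b r : ℝ} (hr : 0 < r) {q : EuclideanSpace ℝ (Fin n)}
    {u : EuclideanSpace ℝ (Fin n) → ℝ} (hu : ∀ y, u y ∈ Icc (-1 : ℝ) 1)
    (hb : ∀ᵐ y ∂(volume.restrict (ball q r)), -1 + b ≤ u y) : b ≤ 2 := by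
  have : NeBot (ae (volume.restrict (ball q r))) := by
    rw [ae_neBot, Ne, Measure.restrict_eq_zero]
    exact (measure_ball_pos volume q hr).ne'
  obtain ⟨y, hy⟩ := hb.exists
  linarith [(hu y).2]

/-- Iterating the single-ball energy drop over a finite family of balls `B_{cδ}(p i)`, where the
balls attached to distinct indices do not interact. -/
theorem SingleBallDrop.finset {n : ℕ} {s b c ς θ : ℝ} {Ω : Set (EuclideanSpace ℝ (Fin n))}
    (hsingle : SingleBallDrop n s b c ς θ Ω) (hc : 0 < c) (hθ : θ ∈ Ioo (0 : ℝ) b)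
    {δ : ℝ} (hδ : 0 < δ) {ι : Type*} {p q : ι → EuclideanSpace ℝ (Fin n)}
    (hpq : ∀ i, dist (p i) (q i) < δ) (hpΩ : ∀ i, ball (p i) (c * δ) ⊆ Ω)
    (hpp : ∀ i j, i ≠ j → Disjoint (ball (p i) (c * δ)) (ball (p j) (c * δ)))
    (hqp : ∀ i j, i ≠ j → Disjoint (ball (q i) (c * δ)) (ball (p j) (c * δ)))
    {u : EuclideanSpace ℝ (Fin n) → ℝ} (hmeas : Measurable u)
    (hval : ∀ y, u y ∈ Icc (-1 : ℝ) 1) (hfin : JQ n s Ω u ≠ ⊤)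
    (hm1 : ∀ i, ∀ᵐ y ∂(volume.restrict (ball (p i) (c * δ))), u y = -1)
    (hb1 : ∀ i, ∀ᵐ y ∂(volume.restrict (ball (q i) (c * δ))), -1 + b ≤ u y)
    (S : Finset ι) :
    ∃ v : EuclideanSpace ℝ (Fin n) → ℝ, Measurable v ∧ (∀ y, v y ∈ Icc (-1 : ℝ) 1) ∧
      (∀ y, (∃ i ∈ S, dist y (p i) < c * δ) → v y = -1 + θ) ∧
      (∀ y, (¬ ∃ i ∈ S, dist y (p i) < c * δ) → v y = u y) ∧
      JQ n s Ω v ≠ ⊤ ∧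
      (JQ n s Ω v).toReal ≤ (JQ n s Ω u).toReal - S.card * ς * δ ^ ((n : ℝ) - 2 * s) := by
  classical
  induction S using Finset.induction_on with
  | empty => exact ⟨u, hmeas, hval, by simp, fun _ _ => rfl, hfin, by simp⟩
  | insert j S hj ih =>
    obtain ⟨v, hvm, hvI, hvS, hvu, hvfin, hvle⟩ := ih
    have off_eq : ∀ a : EuclideanSpace ℝ (Fin n),
        (∀ i ∈ S, Disjoint (ball a (c * δ)) (ball (p i) (c * δ))) →
        ∀ y ∈ ball a (c * δ), v y = u y := by
      intro a ha y hy
      refine hvu y ?_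
      rintro ⟨i, hi, hyi⟩
      exact disjoint_left.mp (ha i hi) hy hyi
    have ne_of_mem : ∀ i ∈ S, j ≠ i := fun i hi h => hj (h ▸ hi)
    have hvp : ∀ᵐ y ∂(volume.restrict (ball (p j) (c * δ))), v y = -1 := by
      filter_upwards [hm1 j, ae_restrict_mem measurableSet_ball] with y hy hyb
      rw [off_eq _ (fun i hi => hpp j i (ne_of_mem i hi)) y hyb, hy]
    have hvq : ∀ᵐ y ∂(volume.restrict (ball (q j) (c * δ))), -1 + b ≤ v y := by
      filter_upwards [hb1 j, ae_restrict_mem measurableSet_ball] with y hy hyb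
      rwa [off_eq _ (fun i hi => hqp j i (ne_of_mem i hi)) y hyb]
    obtain ⟨hfin', hle⟩ :=
      hsingle v hvm hvI hvfin δ hδ (p j) (q j) (hpq j) (hpΩ j) hvp hvq
    have hb2 : b ≤ 2 := le_two_of_ae_ge_on_ball (mul_pos hc hδ) hval (hb1 j)
    refine ⟨fun y => if dist y (p j) < c * δ then -1 + θ else v y,
      Measurable.ite measurableSet_ball measurable_const hvm, fun y => ?_, fun y hy => ?_,
      fun y hy => ?_, hfin', ?_⟩
    · dsimp only
      split_ifs
      · exact ⟨by linarith [hθ.1], by linarith [hθ.2]⟩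
      · exact hvI y
    · by_cases hyj : dist y (p j) < c * δ
      · simp [hyj]
      · rw [Finset.exists_mem_insert] at hy
        simpa [hyj] using hvS y (hy.resolve_left hyj)
    · rw [Finset.exists_mem_insert, not_or] at hy
      simpa [hy.1] using hvu y hy.2
    · rw [Finset.card_insert_of_notMem hj]
      push_cast
      linarith

/-- iterated energy drop: with `ς > 0` and `θ ∈ (0,b)` the constants of
the single-ball energy-drop estimate, if `x₁, …, x_N ∈ Ω` satisfy `|x_i - x_j| > δ` for
`i ≠ j` and `B_{δ/2}(x_i) ⊆ Ω`, and for each `i` there are balls `B_{cδ}(p_i), B_{cδ}(q_i)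
⊆ B_{δ/2}(x_i)` with `ū = -1` a.e. on `B_{cδ}(p_i)` and `ū ≥ -1+b` a.e. on `B_{cδ}(q_i)`,
then the function `u_δ` equal to `-1+θ` on each `B_{cδ}(p_i)` and to `ū` elsewhere satisfies
`u_δ(Q_Ω) ≤ ū(Q_Ω) - N ς δ^{n-2s}`. -/
theorem statement13
    (n : ℕ) (hn : 1 ≤ n) (s : ℝ) (hs : 0 < s) (hs' : s < 1 / 2)
    (b : ℝ) (hb : 0 < b) (c : ℝ) (hc : c ∈ Ioo (0 : ℝ) (1 / 2))
    (Ω : Set (EuclideanSpace ℝ (Fin n))) (hΩo : IsOpen Ω)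
    (ς θ : ℝ) (hς : 0 < ς) (hθ : θ ∈ Ioo (0 : ℝ) b)
    (hsingle : SingleBallDrop n s b c ς θ Ω)
    (δ : ℝ) (hδ : 0 < δ) (N : ℕ)
    (x p q : Fin N → EuclideanSpace ℝ (Fin n))
    (hsep : ∀ i j, i ≠ j → δ < dist (x i) (x j))
    (hballs : ∀ i, ball (x i) (δ / 2) ⊆ Ω)
    (hp : ∀ i, ball (p i) (c * δ) ⊆ ball (x i) (δ / 2))
    (hq : ∀ i, ball (q i) (c * δ) ⊆ ball (x i) (δ / 2))
    (ubar : EuclideanSpace ℝ (Fin n) → ℝ) (hmeas : Measurable ubar)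
    (hval : ∀ x, ubar x ∈ Icc (-1 : ℝ) 1) (hfin : JQ n s Ω ubar ≠ ⊤)
    (hm1 : ∀ i, ∀ᵐ y ∂(volume.restrict (ball (p i) (c * δ))), ubar y = -1)
    (hb1 : ∀ i, ∀ᵐ y ∂(volume.restrict (ball (q i) (c * δ))), -1 + b ≤ ubar y) :
    JQ n s Ω (fun y => if ∃ i, dist y (p i) < c * δ then -1 + θ else ubar y) ≠ ⊤ ∧
    (JQ n s Ω (fun y => if ∃ i, dist y (p i) < c * δ then -1 + θ else ubar y)).toReal ≤
      (JQ n s Ω ubar).toReal - N * ς * δ ^ ((n : ℝ) - 2 * s) := by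
  have hcδ : 0 < c * δ := mul_pos hc.1 hδ
  have hdisj : ∀ i j, i ≠ j → Disjoint (ball (x i) (δ / 2)) (ball (x j) (δ / 2)) :=
    fun i j hij => ball_disjoint_ball (by linarith [hsep i j hij])
  have hpq : ∀ i, dist (p i) (q i) < δ := fun i => by
    have h₁ := mem_ball.mp (hp i (mem_ball_self hcδ))
    have h₂ := mem_ball.mp (hq i (mem_ball_self hcδ))
    linarith [dist_triangle_right (p i) (q i) (x i)]
  obtain ⟨v, -, -, hvS, hvu, hvfin, hvle⟩ := hsingle.finset hc.1 hθ hδ hpq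
    (fun i => (hp i).trans (hballs i))
    (fun i j hij => (hdisj i j hij).mono (hp i) (hp j))
    (fun i j hij => (hdisj i j hij).mono (hq i) (hp j))
    hmeas hval hfin hm1 hb1 Finset.univ
  have hv : (fun y => if ∃ i, dist y (p i) < c * δ then -1 + θ else ubar y) = v := by
    funext y
    split_ifs with h
    · exact (hvS y (by simpa using h)).symm
    · exact (hvu y (by simpa using h)).symm
  rw [hv]
  exact ⟨hvfin, by simpa using hvle⟩
end
end
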